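/- arXiv:2002.08308 — 6 statements merged into one kernel-verified Lean document; each statement's English description precedes it below -/
import Mathlib

section
/- Let λ : [0,1] → ℝ satisfy Assumption 1 (with subpower function φ) and Assumption 2 (with constants c₀, y₀, β), and let γ be the trace of the Loewner evolution driven by λ. Then there exists a subpower function φ₁ such that for all 0 ≤ t ≤ t + s ≤ 1 and all y with 0 ≤ s ≤ y² ≤ y₀², one has |γ(t + s) − γ(t)| ≤ φ₁(1/y) · (2/(1 − β)) · y^{1−β}. -/
open MeasureTheory Filter Set

noncomputable section

/-- The open upper half-plane. -/
def UHP : Set ℂ := {z : ℂ | 0 < z.im}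

/-- `f` is the forward Loewner flow of the driver `lam` started at `z`,
existing (staying in the upper half-plane) on `[0, t]`. -/
def IsFwdSolOn (lam : ℝ → ℝ) (z : ℂ) (f : ℝ → ℂ) (t : ℝ) : Prop :=
  f 0 = z ∧ ∀ s ∈ Set.Icc (0:ℝ) t, 0 < (f s).im ∧
    HasDerivAt f (2 / (f s - (lam s : ℂ))) s

/-- A (forward) Loewner chain on `[0, T]` for the driver `lam`: the conformal maps `g t`
from their domains `H t` (the set of points whose Loewner flow exists up to time `t`)
onto the upper half-plane, together with the inverse maps `finv t`. -/
structure FwdLoewnerChain (lam : ℝ → ℝ) (T : ℝ) where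
  g : ℝ → ℂ → ℂ
  H : ℝ → Set ℂ
  finv : ℝ → ℂ → ℂ
  mem_H : ∀ t ∈ Set.Icc (0:ℝ) T, ∀ z : ℂ,
    z ∈ H t ↔ (0 < z.im ∧ IsFwdSolOn lam z (fun s => g s z) t)
  bijOn : ∀ t ∈ Set.Icc (0:ℝ) T, Set.BijOn (g t) (H t) UHP
  g_holo : ∀ t ∈ Set.Icc (0:ℝ) T, DifferentiableOn ℂ (g t) (H t)
  finv_maps : ∀ t ∈ Set.Icc (0:ℝ) T, ∀ w ∈ UHP, finv t w ∈ H t ∧ g t (finv t w) = w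
  finv_holo : ∀ t ∈ Set.Icc (0:ℝ) T, DifferentiableOn ℂ (finv t) UHP

/-- `γ` is the trace of the Loewner chain `ch` with driver `lam` on `[0,T]`:
the continuous curve `γ t = lim_{y→0+} g_t⁻¹ (lam t + i y)`. -/
def HasTrace (lam : ℝ → ℝ) (T : ℝ) (ch : FwdLoewnerChain lam T) (γ : ℝ → ℂ) : Prop :=
  ContinuousOn γ (Set.Icc 0 T) ∧
  ∀ t ∈ Set.Icc (0:ℝ) T,
    Tendsto (fun y : ℝ => ch.finv t ((lam t : ℂ) + y * Complex.I))
      (nhdsWithin 0 (Set.Ioi 0)) (nhds (γ t))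

/-- A subpower function: a nonnegative function growing slower than any positive power. -/
def IsSubpower (φ : ℝ → ℝ) : Prop :=
  (∀ x, 0 ≤ φ x) ∧ ∀ ε : ℝ, 0 < ε → Tendsto (fun x => φ x / x ^ ε) atTop (nhds 0)

/-- The modulus of continuity `osc(f, δ)` of `f` on `[0,1]`. -/
def osc (f : ℝ → ℝ) (δ : ℝ) : ℝ :=
  sSup {d : ℝ | ∃ s ∈ Set.Icc (0:ℝ) 1, ∃ t ∈ Set.Icc (0:ℝ) 1, |t - s| ≤ δ ∧ d = |f t - f s|}

/-- Backward flow data on `[0,t]`: `G s z` solves the Loewner equation and ends at `z`. -/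
def IsFlow (lam : ℝ → ℝ) (t : ℝ) (G : ℝ → ℂ → ℂ) : Prop :=
  ∀ z : ℂ, 0 < z.im → G t z = z ∧ ∀ s ∈ Set.Icc (0:ℝ) t, 0 < (G s z).im ∧
    HasDerivAt (fun r => G r z) (2 / (G s z - (lam s : ℂ))) s

lemma primitive_props {t : ℝ} (ht : 0 ≤ t) {k : ℝ → ℂ} (hk : ContinuousOn k (Set.Icc 0 t)) :
    ContinuousOn (fun s => ∫ r in s..t, k r) (Set.Icc 0 t) ∧
    ∀ s ∈ Set.Ioo 0 t, HasDerivAt (fun s => ∫ r in s..t, k r) (-k s) s := by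
  constructor
  · have := intervalIntegral.continuousOn_primitive_interval_left (a := 0) (b := t) (f := k)
      (μ := volume) (by rw [uIcc_of_le ht]; exact hk.integrableOn_Icc)
    rwa [uIcc_of_le ht] at this
  · intro s hs
    apply intervalIntegral.integral_hasDerivAt_left
    · apply ContinuousOn.intervalIntegrable
      rw [uIcc_of_le hs.2.le]
      exact hk.mono (Icc_subset_Icc hs.1.le le_rfl)
    · exact ContinuousOn.stronglyMeasurableAtFilter isOpen_Ioo
        (hk.mono Ioo_subset_Icc_self) s hs
    · exact hk.continuousAt (Icc_mem_nhds hs.1 hs.2)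

section flow
variable {lam : ℝ → ℝ} {t : ℝ} {G : ℝ → ℂ → ℂ}

lemma flow_hasDerivAt_im (hG : IsFlow lam t G) {z : ℂ} (hz : 0 < z.im) {s : ℝ}
    (hs : s ∈ Set.Icc 0 t) :
    HasDerivAt (fun r => (G r z).im)
      (-(2 * (G s z).im / ‖G s z - (lam s : ℂ)‖ ^ 2)) s := by
  have h := ((hG z hz).2 s hs).2
  have h2 := (Complex.imCLM.hasFDerivAt.comp_hasDerivAt s h)
  have e : Complex.imCLM (2 / (G s z - (lam s : ℂ))) =
      (-(2 * (G s z).im / ‖G s z - (lam s : ℂ)‖ ^ 2)) := by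
    rw [Complex.sq_norm]
    simp [Complex.div_im]
  rw [e] at h2
  exact h2

lemma flow_im_ge (hG : IsFlow lam t G) {z : ℂ} (hz : 0 < z.im) {s : ℝ}
    (hs : s ∈ Set.Icc 0 t) : z.im ≤ (G s z).im := by
  have anti : AntitoneOn (fun r => (G r z).im) (Set.Icc 0 t) := by
    apply antitoneOn_of_deriv_nonpos (convex_Icc 0 t)
    · intro r hr
      exact (flow_hasDerivAt_im hG hz hr).continuousAt.continuousWithinAt
    · intro r hr
      exact (flow_hasDerivAt_im hG hz (interior_subset hr)).differentiableAt.differentiableWithinAt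
    · intro r hr
      rw [(flow_hasDerivAt_im hG hz (interior_subset hr)).deriv]
      have := ((hG z hz).2 r (interior_subset hr)).1
      have : 0 ≤ (2 * (G r z).im / ‖G r z - (lam r : ℂ)‖ ^ 2) := by positivity
      linarith
  have := anti hs (right_mem_Icc.2 (hs.1.trans hs.2)) hs.2
  simpa [(hG z hz).1] using this

lemma flow_norm_ge (hG : IsFlow lam t G) {z : ℂ} (hz : 0 < z.im) {s : ℝ}
    (hs : s ∈ Set.Icc 0 t) : z.im ≤ ‖G s z - (lam s : ℂ)‖ := by
  refine (flow_im_ge hG hz hs).trans ?_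
  have := Complex.abs_im_le_norm (G s z - (lam s : ℂ))
  simp at this
  exact (le_abs_self _).trans this

lemma flow_ne (hG : IsFlow lam t G) {z : ℂ} (hz : 0 < z.im) {s : ℝ}
    (hs : s ∈ Set.Icc 0 t) : G s z - (lam s : ℂ) ≠ 0 := by
  have := flow_norm_ge hG hz hs
  exact norm_pos_iff.1 (hz.trans_le this)

lemma flow_cont (hlam : ContinuousOn lam (Set.Icc 0 t)) (hG : IsFlow lam t G)
    {z : ℂ} (hz : 0 < z.im) :
    ContinuousOn (fun s => G s z - (lam s : ℂ)) (Set.Icc 0 t) := by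
  apply ContinuousOn.sub
  · intro s hs
    exact ((hG z hz).2 s hs).2.continuousAt.continuousWithinAt
  · exact Complex.continuous_ofReal.comp_continuousOn hlam

/-- the two-point kernel -/
def kern (lam : ℝ → ℝ) (G : ℝ → ℂ → ℂ) (z w : ℂ) (r : ℝ) : ℂ :=
  2 / ((G r z - (lam r : ℂ)) * (G r w - (lam r : ℂ)))

lemma kern_cont (hlam : ContinuousOn lam (Set.Icc 0 t)) (hG : IsFlow lam t G)
    {z w : ℂ} (hz : 0 < z.im) (hw : 0 < w.im) :
    ContinuousOn (kern lam G z w) (Set.Icc 0 t) := by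
  unfold kern
  refine continuousOn_const.div ((flow_cont hlam hG hz).mul (flow_cont hlam hG hw)) ?_
  intro s hs
  exact mul_ne_zero (flow_ne hG hz hs) (flow_ne hG hw hs)

lemma kern_bound (hG : IsFlow lam t G)
    {z w : ℂ} (hz : 0 < z.im) (hw : 0 < w.im) {r : ℝ} (hr : r ∈ Set.Icc 0 t) :
    ‖kern lam G z w r‖ ≤ 2 / (z.im * w.im) := by
  unfold kern
  rw [norm_div, norm_mul]
  have h1 := flow_norm_ge hG hz hr
  have h2 := flow_norm_ge hG hw hr
  have : ‖(2:ℂ)‖ = 2 := by simp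
  rw [this]
  gcongr

lemma two_point (hlam : ContinuousOn lam (Set.Icc 0 t)) (hG : IsFlow lam t G)
    {z w : ℂ} (hz : 0 < z.im) (hw : 0 < w.im) {s : ℝ} (hs : s ∈ Set.Icc 0 t) :
    G s z - G s w = (z - w) * Complex.exp (∫ r in s..t, kern lam G z w r) := by
  have ht : 0 ≤ t := hs.1.trans hs.2
  obtain ⟨pc, pd⟩ := primitive_props ht (kern_cont hlam hG hz hw)
  set P : ℝ → ℂ := fun s => ∫ r in s..t, kern lam G z w r with hP
  have hPt : P t = 0 := by simp [hP]
  have key := intervalIntegral.integral_eq_sub_of_hasDeriv_right_of_le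
    (f := fun s => (G s z - G s w) * Complex.exp (-P s)) (f' := fun _ => 0) hs.2 ?_ ?_ ?_
  · simp only [intervalIntegral.integral_zero, hPt, (hG z hz).1, (hG w hw).1] at key
    simp only [neg_zero, Complex.exp_zero, mul_one] at key
    have e : (z - w) = (G s z - G s w) * Complex.exp (-P s) := sub_eq_zero.1 key.symm
    rw [e, mul_assoc, ← Complex.exp_add]
    simp [hP]
  · have hsub : Set.Icc s t ⊆ Set.Icc 0 t := Icc_subset_Icc hs.1 le_rfl
    refine ContinuousOn.mono ?_ hsub
    refine ContinuousOn.mul (ContinuousOn.sub ?_ ?_) (Complex.continuous_exp.comp_continuousOn pc.neg)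
    · exact fun r hr => ((hG z hz).2 r hr).2.continuousAt.continuousWithinAt
    · exact fun r hr => ((hG w hw).2 r hr).2.continuousAt.continuousWithinAt
  · intro r hr
    have hr' : r ∈ Set.Ioo 0 t := ⟨hs.1.trans_lt hr.1, hr.2⟩
    have hr'' := Ioo_subset_Icc_self hr'
    have d := (((hG z hz).2 r hr'').2.sub ((hG w hw).2 r hr'').2).mul (pd r hr').neg.cexp
    have n1 := flow_ne hG hz hr''
    have n2 := flow_ne hG hw hr''
    refine HasDerivAt.hasDerivWithinAt (d.congr_deriv ?_)
    simp only [kern, Pi.sub_apply, Pi.neg_apply]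
    field_simp
    ring
  · simp

lemma int_kern_bound (hG : IsFlow lam t G)
    {z w : ℂ} (hz : 0 < z.im) (hw : 0 < w.im) {s : ℝ} (hs : s ∈ Set.Icc 0 t) :
    ‖∫ r in s..t, kern lam G z w r‖ ≤ 2 / (z.im * w.im) * t := by
  refine (intervalIntegral.norm_integral_le_of_norm_le_const (C := 2 / (z.im * w.im)) ?_).trans ?_
  · intro r hr
    rw [uIoc_of_le hs.2] at hr
    exact kern_bound hG hz hw ⟨hs.1.trans hr.1.le, hr.2⟩
  · have : |t - s| ≤ t := by rw [abs_of_nonneg (by linarith [hs.2])]; linarith [hs.1]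
    gcongr

lemma im_half {z w : ℂ} (h : w ∈ Metric.ball z (z.im / 2)) : z.im / 2 < w.im := by
  rw [Metric.mem_ball, Complex.dist_eq] at h
  have := (Complex.abs_im_le_norm (w - z)).trans_lt h
  rw [Complex.sub_im, abs_lt] at this
  linarith [this.1]

lemma flow_z_cont (hlam : ContinuousOn lam (Set.Icc 0 t)) (hG : IsFlow lam t G)
    {z : ℂ} (hz : 0 < z.im) {s : ℝ} (hs : s ∈ Set.Icc 0 t) :
    ContinuousAt (G s) z := by
  have ht : 0 ≤ t := hs.1.trans hs.2
  apply continuousAt_of_locally_lipschitz (r := z.im / 2) (by linarith)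
    (Real.exp (2 / (z.im / 2 * z.im) * t))
  intro w hw
  have hw' := im_half (z := z) (w := w) hw
  have hw0 : 0 < w.im := by linarith
  rw [Complex.dist_eq, Complex.dist_eq, two_point hlam hG hw0 hz hs, norm_mul, mul_comm]
  gcongr
  refine (Complex.norm_exp_le_exp_norm _).trans (Real.exp_le_exp.2 ?_)
  refine (int_kern_bound hG hw0 hz hs).trans ?_
  gcongr

lemma kern_aesm (hlam : ContinuousOn lam (Set.Icc 0 t)) (hG : IsFlow lam t G)
    {z w : ℂ} (hz : 0 < z.im) (hw : 0 < w.im) {s : ℝ} (hs : s ∈ Set.Icc 0 t) :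
    AEStronglyMeasurable (kern lam G z w) (volume.restrict (Set.uIoc s t)) := by
  have : ContinuousOn (kern lam G z w) (Set.uIoc s t) := by
    refine (kern_cont hlam hG hz hw).mono ?_
    rw [uIoc_of_le hs.2]
    exact fun r hr => ⟨hs.1.trans hr.1.le, hr.2⟩
  exact this.aestronglyMeasurable measurableSet_uIoc

lemma flow_z_deriv (hlam : ContinuousOn lam (Set.Icc 0 t)) (hG : IsFlow lam t G)
    {z : ℂ} (hz : 0 < z.im) {s : ℝ} (hs : s ∈ Set.Icc 0 t) :
    HasDerivAt (G s) (Complex.exp (∫ r in s..t, kern lam G z z r)) z := by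
  have ht : 0 ≤ t := hs.1.trans hs.2
  have hball : Metric.ball z (z.im / 2) ∈ nhds z := Metric.ball_mem_nhds _ (by linarith)
  have hc : ContinuousAt (fun w => ∫ r in s..t, kern lam G w z r) z := by
    apply intervalIntegral.continuousAt_of_dominated_interval
      (bound := fun _ => 2 / (z.im / 2 * z.im))
    · filter_upwards [hball] with w hw
      have hw' := im_half hw
      exact kern_aesm hlam hG (by linarith) hz hs
    · filter_upwards [hball] with w hw
      have hw' := im_half hw
      refine Filter.Eventually.of_forall fun r hr => ?_
      rw [uIoc_of_le hs.2] at hr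
      refine (kern_bound hG (by linarith) hz ⟨hs.1.trans hr.1.le, hr.2⟩).trans ?_
      gcongr
    · simp
    · refine Filter.Eventually.of_forall fun r hr => ?_
      rw [uIoc_of_le hs.2] at hr
      have hr' : r ∈ Set.Icc 0 t := ⟨hs.1.trans hr.1.le, hr.2⟩
      have := flow_z_cont hlam hG hz hr'
      unfold kern
      refine ContinuousAt.div continuousAt_const ((this.sub continuousAt_const).mul
        continuousAt_const) ?_
      exact mul_ne_zero (flow_ne hG hz hr') (flow_ne hG hz hr')
  rw [hasDerivAt_iff_tendsto_slope]
  have h1 := (Complex.continuous_exp.continuousAt.comp hc).tendsto.mono_left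
    (nhdsWithin_le_nhds (s := {z}ᶜ))
  refine h1.congr' ?_
  filter_upwards [self_mem_nhdsWithin, mem_nhdsWithin_of_mem_nhds hball] with w hw hw2
  have hw' := im_half hw2
  have hne : w - z ≠ 0 := sub_ne_zero.2 hw
  rw [slope_def_field, two_point hlam hG (by linarith) hz hs]
  simp only [Function.comp]
  field_simp

/-- the logarithm of the derivative -/
def Lf (lam : ℝ → ℝ) (G : ℝ → ℂ → ℂ) (t : ℝ) (z : ℂ) : ℂ := ∫ r in (0:ℝ)..t, kern lam G z z r

lemma Lf_deriv (ht : 0 ≤ t) (hlam : ContinuousOn lam (Set.Icc 0 t)) (hG : IsFlow lam t G)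
    {z : ℂ} (hz : 0 < z.im) :
    HasDerivAt (Lf lam G t) (∫ s in (0:ℝ)..t,
      -4 * Complex.exp (∫ r in s..t, kern lam G z z r) / (G s z - (lam s : ℂ)) ^ 3) z := by
  have hball : Metric.ball z (z.im / 2) ∈ nhds z := Metric.ball_mem_nhds _ (by linarith)
  have h0 : (0:ℝ) ∈ Set.Icc 0 t := ⟨le_rfl, ht⟩
  have := intervalIntegral.hasDerivAt_integral_of_dominated_loc_of_deriv_le
    (μ := volume) (a := 0) (b := t) (F := fun z => kern lam G z z) (x₀ := z)
    (F' := fun z s => -4 * Complex.exp (∫ r in s..t, kern lam G z z r) / (G s z - (lam s : ℂ)) ^ 3)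
    (bound := fun _ => 4 * Real.exp (2 / (z.im / 2 * (z.im / 2)) * t) / (z.im / 2) ^ 3)
    hball ?_ ?_ ?_ ?_ ?_ ?_
  · exact this.2
  · filter_upwards [hball] with w hw
    have hw' := im_half hw
    exact kern_aesm hlam hG (by linarith) (by linarith) h0
  · apply ContinuousOn.intervalIntegrable
    rw [uIcc_of_le ht]
    exact kern_cont hlam hG hz hz
  · have : ContinuousOn (fun s => -4 * Complex.exp (∫ r in s..t, kern lam G z z r) /
        (G s z - (lam s : ℂ)) ^ 3) (Set.Icc 0 t) := by
      refine ContinuousOn.div (continuousOn_const.mul (Complex.continuous_exp.comp_continuousOn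
        (primitive_props ht (kern_cont hlam hG hz hz)).1)) ((flow_cont hlam hG hz).pow 3) ?_
      exact fun s hs => pow_ne_zero _ (flow_ne hG hz hs)
    refine (this.mono ?_).aestronglyMeasurable measurableSet_uIoc
    rw [uIoc_of_le ht]
    exact Ioc_subset_Icc_self
  · refine Filter.Eventually.of_forall fun r hr w hw => ?_
    rw [uIoc_of_le ht] at hr
    have hr' := Ioc_subset_Icc_self hr
    have hw' := im_half hw
    have hw0 : 0 < w.im := by linarith
    rw [norm_div, norm_mul, norm_pow]
    have e4 : ‖(-4:ℂ)‖ = 4 := by simp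
    rw [e4]
    have h3 : z.im / 2 ≤ ‖G r w - (lam r : ℂ)‖ := hw'.le.trans (flow_norm_ge hG hw0 hr')
    have h4 : ‖Complex.exp (∫ r in r..t, kern lam G w w r)‖ ≤
        Real.exp (2 / (z.im / 2 * (z.im / 2)) * t) := by
      refine (Complex.norm_exp_le_exp_norm _).trans (Real.exp_le_exp.2 ?_)
      refine (int_kern_bound hG hw0 hw0 hr').trans ?_
      gcongr
    gcongr
  · simp
  · refine Filter.Eventually.of_forall fun r hr w hw => ?_
    rw [uIoc_of_le ht] at hr
    have hr' := Ioc_subset_Icc_self hr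
    have hw' := im_half hw
    have hw0 : 0 < w.im := by linarith
    have d := (flow_z_deriv hlam hG hw0 hr').sub_const (lam r : ℂ)
    have hne := flow_ne hG hw0 hr'
    have d2 := (hasDerivAt_const w (2:ℂ)).div (d.mul d) (mul_ne_zero hne hne)
    refine d2.congr_deriv ?_
    simp only [Pi.mul_apply]
    field_simp
    ring

end flow
section koebe
variable {lam : ℝ → ℝ} {t : ℝ} {G : ℝ → ℂ → ℂ}

lemma koebe_bound (ht : 0 ≤ t) (hlam : ContinuousOn lam (Set.Icc 0 t)) (hG : IsFlow lam t G)
    {z : ℂ} (hz : 0 < z.im) :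
    ‖∫ s in (0:ℝ)..t,
      -4 * Complex.exp (∫ r in s..t, kern lam G z z r) / (G s z - (lam s : ℂ)) ^ 3‖
      ≤ 3 / z.im := by
  obtain ⟨pc, pd⟩ := primitive_props ht (kern_cont hlam hG hz hz)
  set P : ℝ → ℂ := fun s => ∫ r in s..t, kern lam G z z r with hP
  have hPt : P t = 0 := by simp [hP]
  set h : ℝ → ℂ := fun s => G s z - (lam s : ℂ) with hh
  set Y : ℝ → ℝ := fun s => (G s z).im with hY
  have hYt : Y t = z.im := by simp [hY, (hG z hz).1]
  have hYpos : ∀ s ∈ Set.Icc 0 t, 0 < Y s := fun s hs => ((hG z hz).2 s hs).1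
  have hYge : ∀ s ∈ Set.Icc 0 t, z.im ≤ Y s := fun s hs => flow_im_ge hG hz hs
  have hYim : ∀ s, (h s).im = Y s := fun s => by simp [hh, hY]
  have hYd : ∀ s ∈ Set.Icc 0 t, HasDerivAt Y (-(2 * Y s / ‖h s‖ ^ 2)) s :=
    fun s hs => flow_hasDerivAt_im hG hz hs
  have hYc : ContinuousOn Y (Set.Icc 0 t) :=
    fun s hs => (hYd s hs).continuousAt.continuousWithinAt
  have hhc : ContinuousOn h (Set.Icc 0 t) := flow_cont hlam hG hz
  have hne : ∀ s ∈ Set.Icc 0 t, h s ≠ 0 := fun s hs => flow_ne hG hz hs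
  set y := z.im with hy
  set ψ : ℝ → ℂ := fun s => y * Complex.exp (P s) / (Y s : ℂ) with hψ
  set ρ : ℝ → ℝ := fun s => y * Real.exp (P s).re / Y s with hρ
  set dψ : ℝ → ℂ := fun s => 4 * Complex.I * ψ s * Y s / (h s * (‖h s‖ ^ 2 : ℝ)) with hdψ
  set dρ : ℝ → ℝ := fun s => 4 * ρ s * Y s ^ 2 / ‖h s‖ ^ 4 with hdρ
  have hYcc : ContinuousOn (fun s => (Y s : ℂ)) (Set.Icc 0 t) :=
    Complex.continuous_ofReal.comp_continuousOn hYc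
  have hψc : ContinuousOn ψ (Set.Icc 0 t) := by
    refine ContinuousOn.div (continuousOn_const.mul
      (Complex.continuous_exp.comp_continuousOn pc)) hYcc ?_
    intro s hs
    exact_mod_cast (hYpos s hs).ne'
  have hρc : ContinuousOn ρ (Set.Icc 0 t) := by
    refine ContinuousOn.div (continuousOn_const.mul
      (Real.continuous_exp.comp_continuousOn (Complex.continuous_re.comp_continuousOn pc))) hYc ?_
    intro s hs
    exact (hYpos s hs).ne'
  have hdψc : ContinuousOn dψ (Set.Icc 0 t) := by
    refine ContinuousOn.div ((continuousOn_const.mul hψc).mul hYcc)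
      (hhc.mul (Complex.continuous_ofReal.comp_continuousOn (hhc.norm.pow 2))) ?_
    intro s hs
    have := hne s hs
    have h2 : ‖h s‖ ^ 2 ≠ 0 := by positivity
    exact mul_ne_zero this (by exact_mod_cast h2)
  have hdρc : ContinuousOn dρ (Set.Icc 0 t) := by
    refine ContinuousOn.div ((continuousOn_const.mul hρc).mul (hYc.pow 2)) (hhc.norm.pow 4) ?_
    intro s hs
    have := hne s hs
    positivity
  -- algebraic facts
  have alg : ∀ s ∈ Set.Icc 0 t, ∃ c : ℂ, c ≠ 0 ∧ ((‖h s‖ ^ 2 : ℝ) : ℂ) = h s * c ∧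
      h s - c = 2 * Complex.I * Y s := by
    intro s hs
    refine ⟨(starRingEnd ℂ) (h s), ?_, ?_, ?_⟩
    · simpa using hne s hs
    · rw [Complex.mul_conj, Complex.sq_norm]
    · rw [Complex.sub_conj, hYim]; push_cast; ring
  have hψd : ∀ s ∈ Set.Ioo 0 t, HasDerivAt ψ (dψ s) s := by
    intro s hs
    have hs' := Ioo_subset_Icc_self hs
    have hYne : (Y s : ℂ) ≠ 0 := by exact_mod_cast (hYpos s hs').ne'
    have d := (((pd s hs).cexp.const_mul (y : ℂ)).div (hYd s hs').ofReal_comp hYne)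
    refine d.congr_deriv ?_
    obtain ⟨c, hc0, hc1, hc2⟩ := alg s hs'
    have hn := hne s hs'
    simp only [hdψ, hψ]
    rw [Complex.ofReal_neg, Complex.ofReal_div, hc1]
    have hk : kern lam G z z s = 2 / (h s * h s) := rfl
    rw [hk]
    push_cast
    have hYe : (Y s : ℂ) = (h s - c) / (2 * Complex.I) := by
      rw [hc2]; field_simp
    field_simp
    have : h s = c + 2 * Complex.I * Y s := by rw [← hc2]; ring
    rw [this]
    ring
  have hρd : ∀ s ∈ Set.Ioo 0 t, HasDerivAt ρ (dρ s) s := by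
    intro s hs
    have hs' := Ioo_subset_Icc_self hs
    have hYne : Y s ≠ 0 := (hYpos s hs').ne'
    have pre : HasDerivAt (fun s => (P s).re) (-(kern lam G z z s)).re s :=
      (Complex.reCLM.hasFDerivAt.comp_hasDerivAt s (pd s hs))
    have d := ((pre.exp.const_mul y).div (hYd s hs') hYne)
    refine d.congr_deriv ?_
    have hn := hne s hs'
    have hk : kern lam G z z s = 2 / (h s * h s) := rfl
    have hre : (-(kern lam G z z s)).re = -2 * ((h s).re ^ 2 - Y s ^ 2) / ‖h s‖ ^ 4 := by
      rw [hk, Complex.neg_re, Complex.div_re, show ‖h s‖ ^ 4 = (‖h s‖ ^ 2) ^ 2 by ring,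
        Complex.sq_norm, Complex.normSq_mul, ← hYim]
      simp
      ring
    have hN : ‖h s‖ ^ 2 = (h s).re ^ 2 + Y s ^ 2 := by
      rw [Complex.sq_norm, Complex.normSq_apply, hYim]; ring
    have hnp : ‖h s‖ ≠ 0 := by positivity
    rw [hre]
    simp only [hdρ, hρ]
    field_simp
    rw [hN]
    ring
  have hψρ : ∀ s ∈ Set.Icc 0 t, ‖ψ s‖ = ρ s := by
    intro s hs
    have := hYpos s hs
    simp only [hψ, hρ]
    rw [norm_div, norm_mul, Complex.norm_exp, Complex.norm_real, Complex.norm_real,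
      Real.norm_of_nonneg hz.le, Real.norm_of_nonneg this.le]
  have i1 : ∫ s in (0:ℝ)..t, dψ s = ψ t - ψ 0 :=
    intervalIntegral.integral_eq_sub_of_hasDeriv_right_of_le ht hψc
      (fun s hs => (hψd s hs).hasDerivWithinAt)
      (ContinuousOn.intervalIntegrable (by rwa [uIcc_of_le ht]))
  have i2i : IntervalIntegrable dρ volume 0 t :=
    (ContinuousOn.intervalIntegrable (by rwa [uIcc_of_le ht]))
  have i2 : ∫ s in (0:ℝ)..t, dρ s = ρ t - ρ 0 :=
    intervalIntegral.integral_eq_sub_of_hasDeriv_right_of_le ht hρc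
      (fun s hs => (hρd s hs).hasDerivWithinAt) i2i
  have hρt : ρ t = 1 := by simp [hρ, hPt, hYt, hz.ne']
  have hψt : ψ t = 1 := by
    have : (y : ℂ) ≠ 0 := by exact_mod_cast hz.ne'
    simp [hψ, hPt, hYt, this]
  have h0 : (0:ℝ) ∈ Set.Icc 0 t := ⟨le_rfl, ht⟩
  have hρ0 : 0 ≤ ρ 0 := by rw [← hψρ 0 h0]; positivity
  have main : ∫ s in (0:ℝ)..t, (-4 * Complex.exp (P s) / (h s) ^ 3 * y) =
      ∫ s in (0:ℝ)..t, (Complex.I * dψ s + 2 * dψ s * Y s / h s) := by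
    apply intervalIntegral.integral_congr
    intro s hs
    rw [uIcc_of_le ht] at hs
    obtain ⟨c, hc0, hc1, hc2⟩ := alg s hs
    have hn := hne s hs
    have hYne : (Y s : ℂ) ≠ 0 := by exact_mod_cast (hYpos s hs).ne'
    simp only [hdψ, hψ]
    rw [hc1]
    field_simp
    have : h s = c + 2 * Complex.I * Y s := by rw [← hc2]; ring
    rw [this]
    linear_combination (-(y:ℂ) * (c + 2 * Complex.I * Y s)) * Complex.I_sq
  have c2 : ContinuousOn (fun s => 2 * dψ s * Y s / h s) (Set.Icc 0 t) :=
    ContinuousOn.div ((continuousOn_const.mul hdψc).mul hYcc) hhc hne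
  rw [intervalIntegral.integral_add
    (ContinuousOn.intervalIntegrable (by rw [uIcc_of_le ht]; exact continuousOn_const.mul hdψc))
    (ContinuousOn.intervalIntegrable (by rwa [uIcc_of_le ht])),
    intervalIntegral.integral_const_mul, i1, intervalIntegral.integral_mul_const] at main
  have b2 : ‖∫ s in (0:ℝ)..t, 2 * dψ s * Y s / h s‖ ≤ ∫ s in (0:ℝ)..t, 2 * dρ s := by
    apply intervalIntegral.norm_integral_le_of_norm_le ht _ (i2i.const_mul 2)
    refine Filter.Eventually.of_forall fun s hs => ?_
    have hs' := Ioc_subset_Icc_self hs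
    have hYp := hYpos s hs'
    have hn := hne s hs'
    have hnp : ‖h s‖ ≠ 0 := by positivity
    apply le_of_eq
    simp only [hdψ, hdρ]
    simp only [norm_div, norm_mul, Complex.norm_real, hψρ s hs', Complex.norm_I,
      Real.norm_of_nonneg hYp.le, norm_pow, norm_norm, Complex.norm_ofNat]
    field_simp
  rw [intervalIntegral.integral_const_mul, i2, hρt] at b2
  have b1 : ‖Complex.I * (ψ t - ψ 0)‖ ≤ 1 + ρ 0 := by
    rw [norm_mul, Complex.norm_I, one_mul, ← hψρ 0 h0, hψt]
    exact (norm_sub_le _ _).trans (by simp)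
  have tot := norm_add_le (Complex.I * (ψ t - ψ 0)) (∫ s in (0:ℝ)..t, 2 * dψ s * Y s / h s)
  rw [← main, norm_mul, Complex.norm_real, Real.norm_of_nonneg hz.le] at tot
  rw [le_div_iff₀ hz]
  linarith

end koebe

/-- Distortion along a non-tangential upward segment. -/
lemma seg_distortion {L L' : ℂ → ℂ}
    (hL : ∀ z : ℂ, 0 < z.im → HasDerivAt L (L' z) z ∧ ‖L' z‖ ≤ 3 / z.im)
    {z₀ z₁ : ℂ} (h0 : 0 < z₀.im) (h01 : ‖z₁ - z₀‖ ≤ 2 * (z₁.im - z₀.im)) :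
    ∀ a ∈ Set.Icc (0:ℝ) 1, ∀ b ∈ Set.Icc (0:ℝ) 1, a ≤ b →
      |(L (z₀ + b * (z₁ - z₀))).re - (L (z₀ + a * (z₁ - z₀))).re| ≤
        6 * (Real.log (z₀.im + b * (z₁.im - z₀.im)) - Real.log (z₀.im + a * (z₁.im - z₀.im))) := by
  intro a ha b hb hab
  have hd : 0 ≤ z₁.im - z₀.im := by have := norm_nonneg (z₁ - z₀); linarith
  have him : ∀ c : ℝ, (z₀ + c * (z₁ - z₀)).im = z₀.im + c * (z₁.im - z₀.im) := by
    intro c; simp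
  have hpos : ∀ c : ℝ, 0 ≤ c → 0 < z₀.im + c * (z₁.im - z₀.im) := by
    intro c hc; positivity
  have dL : ∀ c : ℝ, 0 ≤ c → HasDerivAt (fun c : ℝ => (L (z₀ + c * (z₁ - z₀))).re)
      ((L' (z₀ + c * (z₁ - z₀))) * (z₁ - z₀)).re c := by
    intro c hc
    have e1 : HasDerivAt (fun c : ℝ => z₀ + (c:ℂ) * (z₁ - z₀)) (z₁ - z₀) c := by
      have := ((Complex.ofRealCLM.hasDerivAt (x := c)).mul_const (z₁ - z₀)).const_add z₀
      simpa using this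
    have e2 := (hL (z₀ + c * (z₁ - z₀)) (by rw [him]; exact hpos c hc)).1
    have e3 := e2.comp c e1
    exact Complex.reCLM.hasFDerivAt.comp_hasDerivAt c e3
  have dlog : ∀ c : ℝ, 0 ≤ c → HasDerivAt (fun c : ℝ => 6 * Real.log (z₀.im + c * (z₁.im - z₀.im)))
      (6 * ((z₁.im - z₀.im) / (z₀.im + c * (z₁.im - z₀.im)))) c := by
    intro c hc
    have e1 : HasDerivAt (fun c : ℝ => z₀.im + c * (z₁.im - z₀.im)) (z₁.im - z₀.im) c := by
      simpa using ((hasDerivAt_id c).mul_const (z₁.im - z₀.im)).const_add z₀.im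
    exact (e1.log (hpos c hc).ne').const_mul 6
  have bd : ∀ c : ℝ, 0 ≤ c → |((L' (z₀ + c * (z₁ - z₀))) * (z₁ - z₀)).re| ≤
      6 * ((z₁.im - z₀.im) / (z₀.im + c * (z₁.im - z₀.im))) := by
    intro c hc
    refine (Complex.abs_re_le_norm _).trans ?_
    rw [norm_mul]
    have h1 := (hL (z₀ + c * (z₁ - z₀)) (by rw [him]; exact hpos c hc)).2
    rw [him] at h1
    have hp := hpos c hc
    calc _ ≤ 3 / (z₀.im + c * (z₁.im - z₀.im)) * (2 * (z₁.im - z₀.im)) := by gcongr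
      _ = _ := by ring
  have key := image_norm_le_of_norm_deriv_right_le_deriv_boundary'
    (f := fun c : ℝ => (L (z₀ + c * (z₁ - z₀))).re - (L (z₀ + a * (z₁ - z₀))).re) (a := a) (b := b)
    (f' := fun c => ((L' (z₀ + c * (z₁ - z₀))) * (z₁ - z₀)).re)
    (B := fun c => 6 * Real.log (z₀.im + c * (z₁.im - z₀.im)) -
      6 * Real.log (z₀.im + a * (z₁.im - z₀.im)))
    (B' := fun c => 6 * ((z₁.im - z₀.im) / (z₀.im + c * (z₁.im - z₀.im))))
    (fun c hc => ((dL c (ha.1.trans hc.1)).sub_const _).continuousAt.continuousWithinAt)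
    (fun c hc => ((dL c (ha.1.trans hc.1)).sub_const _).hasDerivWithinAt)
    (by simp)
    (fun c hc => ((dlog c (ha.1.trans hc.1)).sub_const _).continuousAt.continuousWithinAt)
    (fun c hc => ((dlog c (ha.1.trans hc.1)).sub_const _).hasDerivWithinAt)
    (fun c hc => bd c (ha.1.trans hc.1)) (right_mem_Icc.2 hab)
  simp only [Real.norm_eq_abs] at key
  linarith

lemma seg_bound {f L : ℂ → ℂ} (hf : ∀ z : ℂ, 0 < z.im → HasDerivAt f (Complex.exp (L z)) z)
    {z₀ z₁ : ℂ} {C : ℝ} (h0 : 0 < z₀.im) (h1 : 0 < z₁.im)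
    (hC : ∀ a ∈ Set.Icc (0:ℝ) 1, Real.exp (L (z₀ + a * (z₁ - z₀))).re ≤ C) :
    ‖f z₁ - f z₀‖ ≤ C * ‖z₁ - z₀‖ := by
  have hpos : ∀ a ∈ Set.Icc (0:ℝ) 1, 0 < (z₀ + a * (z₁ - z₀)).im := by
    intro a ha
    have : (z₀ + a * (z₁ - z₀)).im = (1 - a) * z₀.im + a * z₁.im := by simp; ring
    rw [this]
    rcases ha.1.eq_or_lt with h | h
    · rw [← h]; simpa
    · have := ha.2
      have : 0 ≤ (1 - a) * z₀.im := mul_nonneg (by linarith) h0.le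
      positivity
  have key := Convex.norm_image_sub_le_of_norm_hasDerivWithin_le
    (f := fun a : ℝ => f (z₀ + a * (z₁ - z₀))) (s := Set.Icc (0:ℝ) 1)
    (f' := fun a : ℝ => Complex.exp (L (z₀ + a * (z₁ - z₀))) * (z₁ - z₀)) (C := C * ‖z₁ - z₀‖)
    (x := 0) (y := 1) ?_ ?_ (convex_Icc 0 1) (by simp) (by simp)
  · simpa using key
  · intro c hc
    have e1 : HasDerivAt (fun c : ℝ => z₀ + (c:ℂ) * (z₁ - z₀)) (z₁ - z₀) c := by
      have := ((Complex.ofRealCLM.hasDerivAt (x := c)).mul_const (z₁ - z₀)).const_add z₀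
      simpa using this
    exact ((hf _ (hpos c hc)).comp c e1).hasDerivWithinAt
  · intro c hc
    rw [norm_mul, Complex.norm_exp]
    exact mul_le_mul_of_nonneg_right (hC c hc) (norm_nonneg _)

/-- Growth estimate. -/
lemma growth {f L L' : ℂ → ℂ} (hf : ∀ z : ℂ, 0 < z.im → HasDerivAt f (Complex.exp (L z)) z)
    (hL : ∀ z : ℂ, 0 < z.im → HasDerivAt L (L' z) z ∧ ‖L' z‖ ≤ 3 / z.im)
    {z₀ z' : ℂ} {y M D : ℝ} (hy : 0 < y) (h0 : z₀.im = y) (h1 : y ≤ z'.im) (h2 : z'.im ≤ M * y)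
    (hx : |z'.re - z₀.re| ≤ (M - 1) * y) (hD : Real.exp (L z₀).re ≤ D) :
    ‖f z' - f z₀‖ ≤ 3 * M ^ 13 * y * D := by
  have hM : 1 ≤ M := by
    by_contra hcon
    nlinarith
  have hD0 : 0 ≤ D := (Real.exp_pos _).le.trans hD
  set A : ℂ := ⟨z'.re, M * y⟩ with hA
  have hAim : A.im = M * y := rfl
  have n1 : ‖A - z₀‖ ≤ 2 * (A.im - z₀.im) := by
    refine (Complex.norm_le_abs_re_add_abs_im _).trans ?_
    rw [Complex.sub_re, Complex.sub_im, hAim, h0]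
    have : 0 ≤ M * y - y := by nlinarith
    rw [abs_of_nonneg this]
    have : A.re = z'.re := rfl
    rw [this]
    linarith
  have n2' : ‖A - z'‖ ≤ (A.im - z'.im) := by
    refine (Complex.norm_le_abs_re_add_abs_im _).trans ?_
    rw [Complex.sub_re, Complex.sub_im, hAim]
    have : A.re = z'.re := rfl
    rw [this, abs_of_nonneg (by linarith : 0 ≤ M * y - z'.im)]
    simp
  have n2 : ‖A - z'‖ ≤ 2 * (A.im - z'.im) := by
    have := norm_nonneg (A - z')
    linarith
  have hM0 : 0 < M := by linarith
  have hlogM : Real.log (M * y) = Real.log M + Real.log y := Real.log_mul hM0.ne' hy.ne'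
  have hMexp : ∀ n : ℕ, Real.exp (n * Real.log M) = M ^ n := by
    intro n; rw [Real.exp_nat_mul, Real.exp_log hM0]
  have d1 := seg_distortion hL (z₀ := z₀) (z₁ := A) (by rw [h0]; exact hy) n1
  have d2 := seg_distortion hL (z₀ := z') (z₁ := A) (by linarith) n2
  have u1 : ∀ a ∈ Set.Icc (0:ℝ) 1, (L (z₀ + a * (A - z₀))).re ≤ (L z₀).re + 6 * Real.log M := by
    intro a ha
    have := d1 0 (by simp) a ha ha.1
    simp only [Complex.ofReal_zero, zero_mul, add_zero] at this
    have h3 : Real.log (z₀.im + a * (A.im - z₀.im)) ≤ Real.log (M * y) := by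
      have hp : 0 ≤ M * y - y := by nlinarith
      apply Real.log_le_log
      · rw [h0, hAim]; have := mul_nonneg ha.1 hp; linarith
      · rw [h0, hAim]; nlinarith [ha.2]
    rw [h0] at this h3
    linarith [(abs_le.1 this).2]
  have u2 : ∀ a ∈ Set.Icc (0:ℝ) 1, (L (z' + a * (A - z'))).re ≤ (L z₀).re + 12 * Real.log M := by
    intro a ha
    have := d2 a ha 1 (by simp) ha.2
    simp only [Complex.ofReal_one, one_mul, add_sub_cancel] at this
    have h3 : Real.log y ≤ Real.log (z'.im + a * (A.im - z'.im)) := by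
      have hp : 0 ≤ M * y - z'.im := by linarith
      apply Real.log_le_log hy
      rw [hAim]; have := mul_nonneg ha.1 hp; linarith
    have h4 := u1 1 (by simp)
    simp only [Complex.ofReal_one, one_mul, add_sub_cancel] at h4
    rw [hAim] at this h3
    linarith [(abs_le.1 this).1]
  have b1 : ‖f A - f z₀‖ ≤ D * M ^ 12 * ‖A - z₀‖ := by
    apply seg_bound hf (by rw [h0]; exact hy) (by rw [hAim]; positivity)
    intro a ha
    calc _ ≤ Real.exp ((L z₀).re + 12 * Real.log M) := by
            apply Real.exp_le_exp.2
            have := u1 a ha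
            have := Real.log_nonneg hM
            linarith
      _ = Real.exp (L z₀).re * M ^ 12 := by
            rw [Real.exp_add, ← hMexp]; norm_num
      _ ≤ _ := by gcongr
  have b2 : ‖f A - f z'‖ ≤ D * M ^ 12 * ‖A - z'‖ := by
    apply seg_bound hf (by linarith) (by rw [hAim]; positivity)
    intro a ha
    calc _ ≤ Real.exp ((L z₀).re + 12 * Real.log M) := Real.exp_le_exp.2 (u2 a ha)
      _ = Real.exp (L z₀).re * M ^ 12 := by
            rw [Real.exp_add, ← hMexp]; norm_num
      _ ≤ _ := by gcongr
  have e : f z' - f z₀ = (f A - f z₀) - (f A - f z') := by ring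
  rw [e]
  refine (norm_sub_le _ _).trans ((add_le_add b1 b2).trans ?_)
  rw [← mul_add]
  have : ‖A - z₀‖ + ‖A - z'‖ ≤ 3 * (M * y) := by
    rw [hAim] at n1 n2'
    linarith
  calc _ ≤ D * M ^ 12 * (3 * (M * y)) := by gcongr
    _ = _ := by ring

lemma IsSubpower.const {c : ℝ} (hc : 0 ≤ c) : IsSubpower (fun _ => c) := by
  refine ⟨fun _ => hc, fun ε hε => ?_⟩
  exact tendsto_const_nhds.div_atTop (tendsto_rpow_atTop hε)

lemma IsSubpower.add {f g : ℝ → ℝ} (hf : IsSubpower f) (hg : IsSubpower g) :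
    IsSubpower (fun x => f x + g x) := by
  refine ⟨fun x => add_nonneg (hf.1 x) (hg.1 x), fun ε hε => ?_⟩
  simpa [add_div] using (hf.2 ε hε).add (hg.2 ε hε)

lemma IsSubpower.mul {f g : ℝ → ℝ} (hf : IsSubpower f) (hg : IsSubpower g) :
    IsSubpower (fun x => f x * g x) := by
  refine ⟨fun x => mul_nonneg (hf.1 x) (hg.1 x), fun ε hε => ?_⟩
  have h := (hf.2 (ε / 2) (by linarith)).mul (hg.2 (ε / 2) (by linarith))
  rw [mul_zero] at h
  refine h.congr' ?_
  filter_upwards [eventually_gt_atTop 0] with x hx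
  rw [div_mul_div_comm, ← Real.rpow_add hx, add_halves]

lemma IsSubpower.pow {f : ℝ → ℝ} (hf : IsSubpower f) (n : ℕ) :
    IsSubpower (fun x => f x ^ n) := by
  induction n with
  | zero => simpa using IsSubpower.const zero_le_one
  | succ k ih => simpa [pow_succ] using ih.mul hf

lemma IsSubpower.comp_sq {f : ℝ → ℝ} (hf : IsSubpower f) :
    IsSubpower (fun x => f (max (x ^ 2) 1)) := by
  refine ⟨fun x => hf.1 _, fun ε hε => ?_⟩
  have h := (hf.2 (ε / 2) (by linarith)).comp (tendsto_pow_atTop (α := ℝ) (n := 2) (by norm_num))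
  refine h.congr' ?_
  filter_upwards [eventually_ge_atTop 1] with x hx
  have h0 : 0 ≤ x := by linarith
  simp only [Function.comp]
  rw [max_eq_left (by nlinarith), ← Real.rpow_natCast, ← Real.rpow_mul h0]
  congr 2
  push_cast; ring

lemma abs_le_osc {lam : ℝ → ℝ} (hcont : ContinuousOn lam (Set.Icc 0 1)) {a b δ : ℝ}
    (ha : a ∈ Set.Icc (0:ℝ) 1) (hb : b ∈ Set.Icc (0:ℝ) 1) (h : |b - a| ≤ δ) :
    |lam b - lam a| ≤ osc lam δ := by
  obtain ⟨C, hC⟩ := isCompact_Icc.exists_bound_of_continuousOn hcont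
  apply le_csSup
  · refine ⟨C + C, ?_⟩
    rintro d ⟨s, hs, t, ht, -, rfl⟩
    have := abs_sub (lam t) (lam s)
    have h1 := hC s hs
    have h2 := hC t ht
    rw [Real.norm_eq_abs] at h1 h2
    linarith
  · exact ⟨a, ha, b, hb, h, rfl⟩

section chain
variable {lam : ℝ → ℝ}

lemma chain_flow (ch : FwdLoewnerChain lam 1) {t : ℝ} (ht : t ∈ Set.Icc (0:ℝ) 1) :
    IsFlow lam t (fun s z => ch.g s (ch.finv t z)) ∧
    ∀ z : ℂ, 0 < z.im → ch.g 0 (ch.finv t z) = ch.finv t z := by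
  have key : ∀ z : ℂ, 0 < z.im → _ := fun z hz =>
    ((ch.mem_H t ht _).1 (ch.finv_maps t ht z hz).1).2
  refine ⟨fun z hz => ⟨(ch.finv_maps t ht z hz).2, (key z hz).2⟩, fun z hz => (key z hz).1⟩

lemma chain_log (hcont : ContinuousOn lam (Set.Icc 0 1)) (ch : FwdLoewnerChain lam 1) {t : ℝ}
    (ht : t ∈ Set.Icc (0:ℝ) 1) :
    ∃ L L' : ℂ → ℂ, (∀ z : ℂ, 0 < z.im → HasDerivAt (ch.finv t) (Complex.exp (L z)) z) ∧
      ∀ z : ℂ, 0 < z.im → HasDerivAt L (L' z) z ∧ ‖L' z‖ ≤ 3 / z.im := by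
  obtain ⟨hG, h0⟩ := chain_flow ch ht
  have hlam : ContinuousOn lam (Set.Icc 0 t) := hcont.mono (Icc_subset_Icc le_rfl ht.2)
  refine ⟨Lf lam (fun s z => ch.g s (ch.finv t z)) t, _, fun z hz => ?_,
    fun z hz => ⟨Lf_deriv ht.1 hlam hG hz, koebe_bound ht.1 hlam hG hz⟩⟩
  have d := flow_z_deriv hlam hG hz (s := 0) ⟨le_rfl, ht.1⟩
  refine d.congr_of_eventuallyEq ?_
  have : {w : ℂ | 0 < w.im} ∈ nhds z :=
    (isOpen_lt continuous_const Complex.continuous_im).mem_nhds hz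
  filter_upwards [this] with w hw
  exact (h0 w hw).symm

/-- the transition point -/
lemma chain_step (ch : FwdLoewnerChain lam 1) {t s y : ℝ} (ht : 0 ≤ t) (hs : 0 ≤ s)
    (hts : t + s ≤ 1) (hy : 0 < y) (hsy : s ≤ y ^ 2) {z : ℂ} (hz : z.im = y) :
    ∃ z' : ℂ, ch.finv t z' = ch.finv (t + s) z ∧ y ≤ z'.im ∧ ‖z' - z‖ ≤ 2 * y := by
  have ht1 : t ∈ Set.Icc (0:ℝ) 1 := ⟨ht, by linarith⟩
  have hts1 : t + s ∈ Set.Icc (0:ℝ) 1 := ⟨by linarith, hts⟩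
  have hz0 : 0 < z.im := by rw [hz]; exact hy
  obtain ⟨hG, h0⟩ := chain_flow ch hts1
  have htm : t ∈ Set.Icc 0 (t + s) := ⟨ht, by linarith⟩
  set w := ch.finv (t + s) z with hw
  obtain ⟨wp, ws⟩ := (ch.mem_H _ hts1 w).1 (ch.finv_maps _ hts1 z hz0).1
  have wH : w ∈ ch.H t := (ch.mem_H t ht1 w).2
    ⟨wp, ws.1, fun r hr => ws.2 r ⟨hr.1, hr.2.trans htm.2⟩⟩
  refine ⟨ch.g t w, ?_, ?_, ?_⟩
  · have hU : ch.g t w ∈ UHP := (ch.bijOn t ht1).mapsTo wH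
    obtain ⟨m1, m2⟩ := ch.finv_maps t ht1 _ hU
    exact (ch.bijOn t ht1).injOn m1 wH m2
  · rw [← hz]; exact flow_im_ge hG hz0 htm
  · have key := Convex.norm_image_sub_le_of_norm_hasDerivWithin_le
      (f := fun r => ch.g r w) (f' := fun r => 2 / (ch.g r w - (lam r : ℂ)))
      (s := Set.Icc t (t + s)) (C := 2 / y) (x := t + s) (y := t) ?_ ?_ (convex_Icc _ _)
      (right_mem_Icc.2 htm.2) (left_mem_Icc.2 htm.2)
    · have e : ch.g (t + s) w = z := (hG z hz0).1
      simp only [e] at key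
      refine key.trans ?_
      rw [show t - (t + s) = -s by ring, norm_neg, Real.norm_of_nonneg hs, div_mul_eq_mul_div,
        div_le_iff₀ hy]
      nlinarith
    · exact fun r hr => (ws.2 r ⟨ht.trans hr.1, hr.2⟩).2.hasDerivWithinAt
    · intro r hr
      have := flow_norm_ge hG hz0 (s := r) ⟨ht.trans hr.1, hr.2⟩
      rw [norm_div, Complex.norm_ofNat]
      rw [hz] at this
      gcongr

lemma tip_bound {c₀ y₀ β : ℝ} (hβ1 : β < 1) (hc₀ : 0 < c₀)
    (ch : FwdLoewnerChain lam 1) {γ : ℝ → ℂ} (hγ : HasTrace lam 1 ch γ)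
    {t : ℝ} (ht : t ∈ Set.Icc (0:ℝ) 1) {L : ℂ → ℂ}
    (hf : ∀ z : ℂ, 0 < z.im → HasDerivAt (ch.finv t) (Complex.exp (L z)) z)
    (hb : ∀ y : ℝ, 0 < y → y ≤ y₀ →
      Real.exp (L ((lam t : ℂ) + y * Complex.I)).re ≤ c₀ * y ^ (-β))
    {y : ℝ} (hy : 0 < y) (hyy : y ≤ y₀) :
    ‖ch.finv t ((lam t : ℂ) + y * Complex.I) - γ t‖ ≤ c₀ / (1 - β) * y ^ (1 - β) := by
  have hlim := (hγ.2 t ht).const_sub (ch.finv t ((lam t : ℂ) + y * Complex.I))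
  refine le_of_tendsto hlim.norm ?_
  have hm : Set.Ioo 0 y ∈ nhdsWithin (0:ℝ) (Set.Ioi 0) := Ioo_mem_nhdsGT hy
  have hb1 : 0 < 1 - β := by linarith
  filter_upwards [hm] with e he
  have dB : ∀ r : ℝ, 0 < r → HasDerivAt (fun r : ℝ => c₀ / (1 - β) * r ^ (1 - β))
      (c₀ * r ^ (-β)) r := by
    intro r hr
    refine ((Real.hasDerivAt_rpow_const (p := 1 - β) (Or.inl hr.ne')).const_mul
      (c₀ / (1 - β))).congr_deriv ?_
    rw [show 1 - β - 1 = -β by ring]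
    field_simp
  have df : ∀ r : ℝ, 0 < r → HasDerivAt
      (fun r : ℝ => ch.finv t ((lam t : ℂ) + r * Complex.I))
      (Complex.exp (L ((lam t : ℂ) + r * Complex.I)) * Complex.I) r := by
    intro r hr
    have e1 : HasDerivAt (fun c : ℝ => (lam t : ℂ) + (c:ℂ) * Complex.I) Complex.I r := by
      have := ((Complex.ofRealCLM.hasDerivAt (x := r)).mul_const Complex.I).const_add (lam t : ℂ)
      simpa using this
    exact (hf _ (by simpa using hr)).comp r e1
  have key := image_norm_le_of_norm_deriv_right_le_deriv_boundary'
    (f := fun r : ℝ => ch.finv t ((lam t : ℂ) + r * Complex.I) -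
      ch.finv t ((lam t : ℂ) + e * Complex.I)) (a := e) (b := y)
    (f' := fun r => Complex.exp (L ((lam t : ℂ) + r * Complex.I)) * Complex.I)
    (B := fun r : ℝ => c₀ / (1 - β) * r ^ (1 - β))
    (B' := fun r => c₀ * r ^ (-β))
    (fun c hc => ((df c (he.1.trans_le hc.1)).sub_const _).continuousAt.continuousWithinAt)
    (fun c hc => ((df c (he.1.trans_le hc.1)).sub_const _).hasDerivWithinAt)
    (by simp only [sub_self, norm_zero]; have := he.1; positivity)
    (fun c hc => (dB c (he.1.trans_le hc.1)).continuousAt.continuousWithinAt)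
    (fun c hc => (dB c (he.1.trans_le hc.1)).hasDerivWithinAt)
    (fun c hc => by
      rw [norm_mul, Complex.norm_I, mul_one, Complex.norm_exp]
      exact hb c (he.1.trans_le hc.1) (hc.2.le.trans hyy)) (right_mem_Icc.2 he.2.le)
  exact key

end chain

/-- **Uniform continuity of the trace** (Johansson Viklund–Lawler, Proposition 3.8).
Let `lam : [0,1] → ℝ` satisfy Assumption 1 (with subpower function `φ`) and Assumption 2
(with constants `c₀, y₀, β`), and let `γ` be the trace of the Loewner evolution driven by
`lam`. Then there is a subpower function `φ₁` such that for all `0 ≤ t ≤ t + s ≤ 1` and all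
`y` with `0 ≤ s ≤ y² ≤ y₀²`,
`|γ(t+s) − γ(t)| ≤ φ₁(1/y) · (2/(1−β)) · y^{1−β}`. -/
theorem trace_uniform_continuity
    (φ : ℝ → ℝ) (hφ : IsSubpower φ) (c₀ y₀ β : ℝ) (hc₀ : 0 < c₀) (hy₀ : 0 < y₀)
    (hβ0 : 0 < β) (hβ1 : β < 1)
    (lam : ℝ → ℝ) (hcont : ContinuousOn lam (Set.Icc 0 1))
    (hosc : ∀ δ ∈ Set.Ioc (0:ℝ) 1, osc lam δ ≤ Real.sqrt δ * φ (1/δ))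
    (ch : FwdLoewnerChain lam 1)
    (hderiv : ∀ t ∈ Set.Icc (0:ℝ) 1, ∀ y : ℝ, 0 < y → y ≤ y₀ →
        ‖deriv (fun z => ch.finv t (z + (lam t : ℂ))) ((y : ℂ) * Complex.I)‖ ≤ c₀ * y ^ (-β))
    (γ : ℝ → ℂ) (hγ : HasTrace lam 1 ch γ) :
    ∃ φ₁ : ℝ → ℝ, IsSubpower φ₁ ∧
      ∀ t s y : ℝ, 0 ≤ t → 0 ≤ s → t + s ≤ 1 → 0 < y → s ≤ y ^ 2 → y ^ 2 ≤ y₀ ^ 2 →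
        ‖γ (t + s) - γ t‖ ≤ φ₁ (1 / y) * (2 / (1 - β)) * y ^ (1 - β) := by
  set Ψ : ℝ → ℝ := fun x => φ (max (x ^ 2) 1) with hΨ
  have hΨs : IsSubpower Ψ := hφ.comp_sq
  refine ⟨fun x => c₀ * (1 + 3 * (3 + Ψ x) ^ 13), ?_, ?_⟩
  · exact (IsSubpower.const hc₀.le).mul ((IsSubpower.const zero_le_one).add
      ((IsSubpower.const (by norm_num)).mul
        (((IsSubpower.const (by norm_num)).add hΨs).pow 13)))
  intro t s y ht hs hts hy hsy hyy
  have hyy0 : y ≤ y₀ := by nlinarith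
  have ht1 : t ∈ Set.Icc (0:ℝ) 1 := ⟨ht, by linarith⟩
  have hts1 : t + s ∈ Set.Icc (0:ℝ) 1 := ⟨by linarith, hts⟩
  have hb1 : 0 < 1 - β := by linarith
  -- derivative bounds in terms of `L`
  have hb : ∀ u ∈ Set.Icc (0:ℝ) 1, ∀ L : ℂ → ℂ,
      (∀ z : ℂ, 0 < z.im → HasDerivAt (ch.finv u) (Complex.exp (L z)) z) →
      ∀ r : ℝ, 0 < r → r ≤ y₀ →
      Real.exp (L ((lam u : ℂ) + r * Complex.I)).re ≤ c₀ * r ^ (-β) := by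
    intro u hu L hf r hr hr0
    have := hderiv u hu r hr hr0
    rw [deriv_comp_add_const, add_comm, (hf _ (by simpa using hr)).deriv, Complex.norm_exp] at this
    exact this
  obtain ⟨L, L', hf, hL⟩ := chain_log hcont ch ht1
  obtain ⟨L2, L2', hf2, hL2⟩ := chain_log hcont ch hts1
  have T1 := tip_bound hβ1 hc₀ ch hγ ht1 hf (hb t ht1 L hf) hy hyy0
  have T2 := tip_bound hβ1 hc₀ ch hγ hts1 hf2 (hb _ hts1 L2 hf2) hy hyy0
  obtain ⟨z', e1, e2, e3⟩ := chain_step ch ht hs hts hy hsy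
    (z := (lam (t + s) : ℂ) + y * Complex.I) (by simp)
  -- driver oscillation
  have hlamd : |lam (t + s) - lam t| ≤ y * Ψ (1 / y) := by
    have hδ : min (y ^ 2) 1 ∈ Set.Ioc (0:ℝ) 1 := ⟨by positivity, min_le_right _ _⟩
    have h1 := abs_le_osc hcont ht1 hts1 (δ := min (y ^ 2) 1)
      (by rw [add_sub_cancel_left, abs_of_nonneg hs]; exact le_min hsy (by linarith))
    have h2 := hosc _ hδ
    have h3 : 1 / min (y ^ 2) 1 = max ((1 / y) ^ 2) 1 := by
      rcases le_total (y ^ 2) 1 with h | h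
      · rw [min_eq_left h, max_eq_left]
        · rw [one_div_pow]
        · rw [one_div_pow, le_div_iff₀ (by positivity)]; linarith
      · rw [min_eq_right h, max_eq_right]
        · norm_num
        · rw [one_div_pow, div_le_iff₀ (by positivity)]; linarith
    have h4 : Real.sqrt (min (y ^ 2) 1) ≤ y := by
      rw [Real.sqrt_le_left hy.le]; exact min_le_left _ _
    rw [h3] at h2
    refine h1.trans (h2.trans ?_)
    exact mul_le_mul_of_nonneg_right h4 (hφ.1 _)
  have hΨ0 : 0 ≤ Ψ (1 / y) := hΨs.1 _
  set M := 3 + Ψ (1 / y) with hM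
  have him : z'.im ≤ M * y := by
    have h1 := (Complex.abs_im_le_norm _).trans e3
    simp only [Complex.sub_im, Complex.add_im, Complex.ofReal_im, Complex.mul_im,
      Complex.ofReal_re, Complex.I_im, Complex.I_re] at h1
    have := (abs_le.1 h1).2
    have := mul_nonneg hΨ0 hy.le
    rw [hM, add_mul]
    linarith
  have hre : |z'.re - ((lam t : ℂ) + y * Complex.I).re| ≤ (M - 1) * y := by
    have h1 := (Complex.abs_re_le_norm _).trans e3
    simp only [Complex.sub_re, Complex.add_re, Complex.ofReal_re, Complex.mul_re,
      Complex.ofReal_im, Complex.I_im, Complex.I_re, mul_zero, zero_mul, sub_zero,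
      add_zero] at h1 ⊢
    have h2 := abs_sub_le z'.re (lam (t + s)) (lam t)
    calc _ ≤ 2 * y + y * Ψ (1 / y) := by linarith
      _ = _ := by rw [hM]; ring
  have T3 := growth hf hL (z₀ := (lam t : ℂ) + y * Complex.I) hy (by simp) e2 him hre
    (hb t ht1 L hf y hy hyy0)
  rw [e1] at T3
  have hpow : y * y ^ (-β) = y ^ (1 - β) := by
    rw [sub_eq_add_neg, Real.rpow_add hy, Real.rpow_one]
  set Q := y ^ (1 - β) with hQ
  have hQ0 : 0 ≤ Q := by positivity
  have T3' : 3 * M ^ 13 * y * (c₀ * y ^ (-β)) = 3 * M ^ 13 * c₀ * Q := by rw [← hpow]; ring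
  rw [T3'] at T3
  set F := ch.finv t ((lam t : ℂ) + y * Complex.I)
  set F2 := ch.finv (t + s) ((lam (t + s) : ℂ) + y * Complex.I)
  have tri : ‖γ (t + s) - γ t‖ ≤ ‖F2 - γ (t + s)‖ + ‖F2 - F‖ + ‖F - γ t‖ := by
    have : γ (t + s) - γ t = -(F2 - γ (t + s)) + (F2 - F) + (F - γ t) := by ring
    rw [this]
    refine (norm_add₃_le).trans ?_
    rw [norm_neg]
  have hM0 : 0 ≤ M := by positivity
  have h2b : 1 ≤ 2 / (1 - β) := by rw [le_div_iff₀ hb1]; linarith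
  have hX : 0 ≤ 3 * M ^ 13 * c₀ * Q := by positivity
  have hfin : 3 * M ^ 13 * c₀ * Q ≤ 3 * M ^ 13 * c₀ * Q * (2 / (1 - β)) :=
    le_mul_of_one_le_right hX h2b
  calc _ ≤ c₀ / (1 - β) * Q + 3 * M ^ 13 * c₀ * Q * (2 / (1 - β)) + c₀ / (1 - β) * Q := by
        linarith
    _ = _ := by ring

end
end

section
/- Let 0 < T < ∞ and let λ^{(1)}, λ^{(2)} : [0,T] → ℝ be continuous. For j = 1, 2 let h^{(j)}_t(z) solve the backward Loewner equation with driver λ^{(j)}, and assume that z ↦ h^{(j)}_T(z) is complex-differentiable at u = x + iy ∈ ℍ. Set ε = sup_{s∈[0,T]} |λ^{(1)}_s − λ^{(2)}_s| and I_{T,y} = √(4T + y²). Then |h^{(1)}_T(u) − h^{(2)}_T(u)| ≤ ε · exp[ (1/2)·( log(I_{T,y}|(h^{(1)}_T)'(u)|/y) · log(I_{T,y}|(h^{(2)}_T)'(u)|/y) )^{1/2} + log log(I_{T,y}/y) ]. -/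
open MeasureTheory Filter Set

noncomputable section

/-- `h` solves the backward Loewner equation `∂ₜ h(t) = −2/(h(t) − lam(t))`, `h(0) = z`,
on `[0, T]`, staying in the upper half-plane. -/
def IsBwdSolOn (lam : ℝ → ℝ) (z : ℂ) (h : ℝ → ℂ) (T : ℝ) : Prop :=
  h 0 = z ∧ ∀ t ∈ Set.Icc (0:ℝ) T, 0 < (h t).im ∧
    HasDerivAt h (-2 / (h t - (lam t : ℂ))) t

section Helpers
open Topology

lemma lin_ode (a b : ℝ → ℂ) (ha : Continuous a) (hb : Continuous b) (f : ℝ → ℂ) (T : ℝ) (hT : 0 ≤ T)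
    (hf : ∀ t ∈ Icc (0:ℝ) T, HasDerivAt f (a t * f t + b t) t) :
    f T = Complex.exp (∫ r in (0:ℝ)..T, a r) * f 0
      + ∫ s in (0:ℝ)..T, Complex.exp (∫ r in s..T, a r) * b s := by
  have hA : ∀ s, HasDerivAt (fun s => ∫ r in s..T, a r) (-a s) s := fun s =>
    intervalIntegral.integral_hasDerivAt_left (ha.intervalIntegrable _ _)
      (ha.stronglyMeasurableAtFilter _ _) ha.continuousAt
  have hAc : Continuous (fun s => ∫ r in s..T, a r) :=
    continuous_iff_continuousAt.2 fun s => (hA s).continuousAt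
  have hg : ∀ s ∈ uIcc (0:ℝ) T, HasDerivAt (fun s => Complex.exp (∫ r in s..T, a r) * f s)
      (Complex.exp (∫ r in s..T, a r) * b s) s := by
    intro s hs
    rw [uIcc_of_le hT] at hs
    have := ((hA s).cexp).mul (hf s hs)
    refine HasDerivAt.congr_deriv this ?_
    ring
  have := intervalIntegral.integral_eq_sub_of_hasDerivAt hg
    (Continuous.intervalIntegrable (by fun_prop) _ _)
  rw [this]
  simp

lemma cauchy_schwarz_int (f g : ℝ → ℝ) (hf : Continuous f) (hg : Continuous g) (T : ℝ) (hT : 0 ≤ T) :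
    (∫ t in (0:ℝ)..T, f t * g t) ≤
      Real.sqrt ((∫ t in (0:ℝ)..T, f t ^ 2) * ∫ t in (0:ℝ)..T, g t ^ 2) := by
  apply Real.le_sqrt_of_sq_le
  have key : ∀ x : ℝ, 0 ≤ (∫ t in (0:ℝ)..T, f t ^ 2) * (x * x)
      + (-2 * ∫ t in (0:ℝ)..T, f t * g t) * x + ∫ t in (0:ℝ)..T, g t ^ 2 := by
    intro x
    have h0 : 0 ≤ ∫ t in (0:ℝ)..T, (x * f t - g t) ^ 2 :=
      intervalIntegral.integral_nonneg hT (fun t _ => sq_nonneg _)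
    have h1 : (∫ t in (0:ℝ)..T, (x * f t - g t) ^ 2) = ∫ t in (0:ℝ)..T,
        ((x * x) * f t ^ 2 + (-2 * x) * (f t * g t) + g t ^ 2) := by
      congr 1; ext t; ring
    rw [h1, intervalIntegral.integral_add, intervalIntegral.integral_add,
      intervalIntegral.integral_const_mul, intervalIntegral.integral_const_mul] at h0
    · linarith
    all_goals exact Continuous.intervalIntegrable (by fun_prop) _ _
  have := discrim_le_zero key
  unfold discrim at this
  nlinarith

/-- Continuous extension of `h - lam`. -/
def ZZ (T : ℝ) (lam : ℝ → ℝ) (h : ℝ → ℂ) : ℝ → ℂ := fun t => h (max 0 (min t T)) - (lam t : ℂ)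

lemma pr_mem {T : ℝ} (hT : 0 < T) (t : ℝ) : max 0 (min t T) ∈ Icc (0:ℝ) T :=
  ⟨le_max_left _ _, max_le hT.le (min_le_right _ _)⟩

lemma pr_eq {T t : ℝ} (ht : t ∈ Icc (0:ℝ) T) : max 0 (min t T) = t := by
  rw [min_eq_left ht.2, max_eq_right ht.1]

section
variable {T : ℝ} {lam : ℝ → ℝ} {z : ℂ} {h : ℝ → ℂ}

lemma ZZ_eq {t : ℝ} (ht : t ∈ Icc (0:ℝ) T) : ZZ T lam h t = h t - (lam t : ℂ) := by
  unfold ZZ; rw [pr_eq ht]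

lemma ZZ_cont (hT : 0 < T) (hl : Continuous lam) (hs : IsBwdSolOn lam z h T) :
    Continuous (ZZ T lam h) := by
  have h1 : ContinuousOn h (Icc 0 T) := fun t ht => (hs.2 t ht).2.continuousAt.continuousWithinAt
  have h2 : Continuous (fun t : ℝ => h (max 0 (min t T))) :=
    h1.comp_continuous (by fun_prop) (pr_mem hT)
  exact h2.sub (Complex.continuous_ofReal.comp hl)

lemma ZZ_im (hT : 0 < T) (hs : IsBwdSolOn lam z h T) (t : ℝ) : 0 < (ZZ T lam h t).im := by
  have := (hs.2 _ (pr_mem hT t)).1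
  simpa [ZZ] using this

lemma ZZ_ne (hT : 0 < T) (hs : IsBwdSolOn lam z h T) (t : ℝ) : ZZ T lam h t ≠ 0 := by
  intro h0
  have := ZZ_im hT hs t
  rw [h0] at this
  simp at this

lemma ZZ_nsq (hT : 0 < T) (hs : IsBwdSolOn lam z h T) (t : ℝ) : 0 < Complex.normSq (ZZ T lam h t) :=
  Complex.normSq_pos.2 (ZZ_ne hT hs t)

lemma im_deriv (hs : IsBwdSolOn lam z h T) {t : ℝ} (ht : t ∈ Icc (0:ℝ) T) :
    HasDerivAt (fun t => (h t).im) (2 * (h t).im / Complex.normSq (ZZ T lam h t)) t := by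
  have := (Complex.imCLM.hasFDerivAt.comp_hasDerivAt t (hs.2 t ht).2)
  rw [← ZZ_eq ht] at this
  refine HasDerivAt.congr_deriv this ?_
  have : (h t).im = (ZZ T lam h t).im := by rw [ZZ_eq ht]; simp
  rw [this]
  simp [Complex.div_im]
  ring

lemma int_log (hT : 0 < T) (hl : Continuous lam) (hs : IsBwdSolOn lam z h T) {t : ℝ}
    (ht : t ∈ Icc (0:ℝ) T) :
    ∫ s in (0:ℝ)..t, 2 / Complex.normSq (ZZ T lam h s) = Real.log (h t).im - Real.log z.im := by
  have hc := ZZ_cont hT hl hs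
  have := intervalIntegral.integral_eq_sub_of_hasDerivAt (a := 0) (b := t)
    (f := fun s => Real.log (h s).im)
    (f' := fun s => 2 / Complex.normSq (ZZ T lam h s)) (by
      intro s hss
      rw [uIcc_of_le ht.1] at hss
      have hs' : s ∈ Icc (0:ℝ) T := ⟨hss.1, hss.2.trans ht.2⟩
      have hp := (hs.2 s hs').1
      have := (im_deriv hs hs').log hp.ne'
      refine HasDerivAt.congr_deriv this ?_
      have := ZZ_nsq hT hs s
      field_simp)
    (Continuous.intervalIntegrable (by
      refine Continuous.div continuous_const (Complex.continuous_normSq.comp hc)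
        (fun s => (ZZ_nsq hT hs s).ne')) _ _)
  rw [this, hs.1]

lemma im_mono (hT : 0 < T) (hl : Continuous lam) (hs : IsBwdSolOn lam z h T) (hz : 0 < z.im) {t : ℝ}
    (ht : t ∈ Icc (0:ℝ) T) : z.im ≤ (h t).im := by
  have h1 := int_log hT hl hs ht
  have h2 : 0 ≤ ∫ s in (0:ℝ)..t, 2 / Complex.normSq (ZZ T lam h s) :=
    intervalIntegral.integral_nonneg ht.1 (fun s _ => by
      have := ZZ_nsq hT hs s
      positivity)
  exact (Real.log_le_log_iff hz (hs.2 t ht).1).1 (by linarith)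

lemma im_upper (hT : 0 < T) (hl : Continuous lam) (hs : IsBwdSolOn lam z h T) :
    (h T).im ≤ Real.sqrt (4 * T + z.im ^ 2) := by
  have hc := ZZ_cont hT hl hs
  have hd : ∀ t ∈ Icc (0:ℝ) T, HasDerivAt (fun t => (h t).im ^ 2)
      (4 * (ZZ T lam h t).im ^ 2 / Complex.normSq (ZZ T lam h t)) t := by
    intro t ht
    have := (im_deriv hs ht).pow 2
    refine HasDerivAt.congr_deriv this ?_
    have : (h t).im = (ZZ T lam h t).im := by rw [ZZ_eq ht]; simp
    rw [this]
    push_cast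
    ring
  have hcont : Continuous (fun t => 4 * (ZZ T lam h t).im ^ 2 / Complex.normSq (ZZ T lam h t)) :=
    Continuous.div (by have := Complex.continuous_im.comp hc; unfold Function.comp at this; fun_prop)
      (Complex.continuous_normSq.comp hc) (fun s => (ZZ_nsq hT hs s).ne')
  have h1 := intervalIntegral.integral_eq_sub_of_hasDerivAt (a := 0) (b := T)
    (by rw [uIcc_of_le hT.le]; exact hd) (hcont.intervalIntegrable _ _)
  have h2 := intervalIntegral.integral_mono_on (a := 0) (b := T) (μ := volume) hT.le
    (hcont.intervalIntegrable _ _)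
    (g := fun _ => (4:ℝ)) (by simp) (by
      intro t _
      rw [div_le_iff₀ (ZZ_nsq hT hs t), Complex.normSq_apply]
      nlinarith [sq_nonneg (ZZ T lam h t).re])
  simp at h2
  apply Real.le_sqrt_of_sq_le
  rw [hs.1] at h1
  linarith

lemma int_log_le (hT : 0 < T) (hl : Continuous lam) (hs : IsBwdSolOn lam z h T) (hz : 0 < z.im) :
    ∫ s in (0:ℝ)..T, 2 / Complex.normSq (ZZ T lam h s)
      ≤ Real.log (Real.sqrt (4 * T + z.im ^ 2) / z.im) := by
  have hTm : T ∈ Icc (0:ℝ) T := ⟨hT.le, le_rfl⟩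
  rw [int_log hT hl hs hTm, ← Real.log_div (hs.2 T hTm).1.ne' hz.ne']
  apply Real.log_le_log (div_pos (hs.2 T hTm).1 hz)
  gcongr
  exact im_upper hT hl hs

lemma norm_ZZ_ge (hT : 0 < T) (hl : Continuous lam) (hs : IsBwdSolOn lam z h T) (hz : 0 < z.im)
    (t : ℝ) : z.im ≤ ‖ZZ T lam h t‖ := by
  have h1 := im_mono hT hl hs hz (pr_mem hT t)
  have h2 : (ZZ T lam h t).im = (h (max 0 (min t T))).im := by simp [ZZ]
  rw [← h2] at h1
  exact h1.trans ((le_abs_self _).trans (Complex.abs_im_le_norm _))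
end

lemma diff_eq {T : ℝ} (hT : 0 < T) {lam1 lam2 : ℝ → ℝ} (hl1 : Continuous lam1) (hl2 : Continuous lam2)
    {z w : ℂ} {h k : ℝ → ℂ} (hs : IsBwdSolOn lam1 z h T) (ks : IsBwdSolOn lam2 w k T) {t : ℝ}
    (ht : t ∈ Icc (0:ℝ) T) :
    h t - k t = Complex.exp (∫ r in (0:ℝ)..t, 2 / (ZZ T lam1 h r * ZZ T lam2 k r)) * (z - w)
      + ∫ s in (0:ℝ)..t, Complex.exp (∫ r in s..t, 2 / (ZZ T lam1 h r * ZZ T lam2 k r)) *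
        (- (2 / (ZZ T lam1 h s * ZZ T lam2 k s)) * ((lam1 s - lam2 s : ℝ) : ℂ)) := by
  have hc1 := ZZ_cont hT hl1 hs
  have hc2 := ZZ_cont hT hl2 ks
  have hn1 := ZZ_ne hT hs
  have hn2 := ZZ_ne hT ks
  have ha : Continuous fun r => 2 / (ZZ T lam1 h r * ZZ T lam2 k r) :=
    Continuous.div continuous_const (hc1.mul hc2) fun s => mul_ne_zero (hn1 s) (hn2 s)
  have := lin_ode (fun r => 2 / (ZZ T lam1 h r * ZZ T lam2 k r))
    (fun s => - (2 / (ZZ T lam1 h s * ZZ T lam2 k s)) * ((lam1 s - lam2 s : ℝ) : ℂ)) ha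
    (ha.neg.mul (by fun_prop)) (fun t => h t - k t) t ht.1 (by
      intro s hss
      have hs' : s ∈ Icc (0:ℝ) T := ⟨hss.1, hss.2.trans ht.2⟩
      have := (hs.2 s hs').2.sub (ks.2 s hs').2
      refine HasDerivAt.congr_deriv this ?_
      have e1 := hn1 s
      have e2 := hn2 s
      rw [ZZ_eq hs'] at e1 e2 ⊢
      rw [ZZ_eq hs']
      push_cast
      field_simp
      ring)
  simp only [hs.1, ks.1] at this
  exact this

lemma deriv_formula {T : ℝ} (hT : 0 < T) {lam : ℝ → ℝ} (hl : Continuous lam) (h : ℝ → ℂ → ℂ)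
    (hsol : ∀ z ∈ UHP, IsBwdSolOn lam z (fun t => h t z) T)
    (u : ℂ) (hu : 0 < u.im) (d : ℂ) (hd : HasDerivAt (h T) d u) :
    d = Complex.exp (∫ r in (0:ℝ)..T, 2 / (ZZ T lam (fun t => h t u) r * ZZ T lam (fun t => h t u) r)) := by
  have hTm : T ∈ Icc (0:ℝ) T := ⟨hT.le, le_rfl⟩
  set Z : ℂ → ℝ → ℂ := fun w => ZZ T lam (fun t => h t w) with hZ
  have hev : ∀ᶠ w in 𝓝 u, u.im / 2 < w.im :=
    Complex.continuous_im.continuousAt.eventually (lt_mem_nhds (by linarith : u.im / 2 < u.im))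
  have hev' : ∀ᶠ w in 𝓝[≠] u, u.im / 2 < w.im := hev.filter_mono nhdsWithin_le_nhds
  have hD : ∀ w, u.im / 2 < w.im → ∀ t ∈ Icc (0:ℝ) T, h t w - h t u =
      Complex.exp (∫ r in (0:ℝ)..t, 2 / (Z w r * Z u r)) * (w - u) := by
    intro w hw t ht
    have := diff_eq hT hl hl (hsol w (by show 0 < w.im; linarith)) (hsol u hu) ht
    simpa using this
  have hbd : ∀ w, u.im / 2 < w.im → ∀ r, ‖2 / (Z w r * Z u r)‖ ≤ 2 / (u.im / 2 * u.im) := by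
    intro w hw r
    have h1 := norm_ZZ_ge hT hl (hsol w (by show 0 < w.im; linarith)) (by linarith) r
    have h2 := norm_ZZ_ge hT hl (hsol u hu) hu r
    rw [norm_div, norm_mul]
    simp only [Complex.norm_ofNat]
    have : u.im / 2 ≤ ‖Z w r‖ := hw.le.trans h1
    gcongr
  set C := 2 / (u.im / 2 * u.im) with hC
  have hC0 : 0 ≤ C := by positivity
  have hconv : ∀ t ∈ Icc (0:ℝ) T, Tendsto (fun w => h t w) (𝓝[≠] u) (𝓝 (h t u)) := by
    intro t ht
    rw [tendsto_iff_norm_sub_tendsto_zero]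
    have h0 : Tendsto (fun w => Real.exp (C * T) * ‖w - u‖) (𝓝[≠] u) (𝓝 0) := by
      have : Continuous (fun w : ℂ => Real.exp (C * T) * ‖w - u‖) := by fun_prop
      have := (this.tendsto u).mono_left (nhdsWithin_le_nhds (s := {u}ᶜ))
      simpa using this
    refine squeeze_zero' (Eventually.of_forall fun _ => norm_nonneg _) ?_ h0
    filter_upwards [hev'] with w hw
    rw [hD w hw t ht, norm_mul, Complex.norm_exp]
    gcongr
    refine (Complex.re_le_norm _).trans ?_
    have := intervalIntegral.norm_integral_le_of_norm_le_const (a := 0) (b := t) (C := C)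
      (f := fun r => 2 / (Z w r * Z u r)) (fun r _ => hbd w hw r)
    refine this.trans ?_
    rw [sub_zero, abs_of_nonneg ht.1]
    exact mul_le_mul_of_nonneg_left ht.2 hC0
  have hI : Tendsto (fun w => ∫ r in (0:ℝ)..T, 2 / (Z w r * Z u r)) (𝓝[≠] u)
      (𝓝 (∫ r in (0:ℝ)..T, 2 / (Z u r * Z u r))) := by
    apply intervalIntegral.tendsto_integral_filter_of_dominated_convergence (fun _ => C)
    · filter_upwards [hev'] with w hw
      have hw0 : w ∈ UHP := by show 0 < w.im; linarith
      have : Continuous (fun r => 2 / (Z w r * Z u r)) :=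
        Continuous.div continuous_const ((ZZ_cont hT hl (hsol w hw0)).mul (ZZ_cont hT hl (hsol u hu)))
          fun s => mul_ne_zero (ZZ_ne hT (hsol w hw0) s) (ZZ_ne hT (hsol u hu) s)
      exact this.aestronglyMeasurable
    · filter_upwards [hev'] with w hw
      exact Eventually.of_forall fun r _ => hbd w hw r
    · simp
    · refine Eventually.of_forall fun r _ => ?_
      have hne := ZZ_ne hT (hsol u hu) r
      refine Tendsto.div tendsto_const_nhds (Tendsto.mul ?_ tendsto_const_nhds) (mul_ne_zero hne hne)
      exact (hconv _ (pr_mem hT r)).sub tendsto_const_nhds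
  have hE := (Complex.continuous_exp.tendsto _).comp hI
  refine tendsto_nhds_unique (hasDerivAt_iff_tendsto_slope.1 hd) (hE.congr' ?_)
  filter_upwards [hev', self_mem_nhdsWithin] with w hw hne
  have hne' : w - u ≠ 0 := sub_ne_zero.2 hne
  rw [slope_def_field, hD w hw T hTm]
  simp [hne']

/-- `2|x|/|z|²`. -/
def PP (z : ℂ) : ℝ := 2 * |z.re| / Complex.normSq z

lemma int_PP_le {T : ℝ} (hT : 0 < T) {lam : ℝ → ℝ} (hl : Continuous lam) (h : ℝ → ℂ → ℂ)
    (hsol : ∀ z ∈ UHP, IsBwdSolOn lam z (fun t => h t z) T)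
    (u : ℂ) (hu : 0 < u.im) (d : ℂ) (hd : HasDerivAt (h T) d u) :
    ∫ r in (0:ℝ)..T, PP (ZZ T lam (fun t => h t u) r) ^ 2
      ≤ Real.log (Real.sqrt (4 * T + u.im ^ 2) * ‖d‖ / u.im) := by
  have hf := deriv_formula hT hl h hsol u hu d hd
  have hs := hsol u hu
  have hc := ZZ_cont hT hl hs
  have hne := ZZ_ne hT hs
  have hns := ZZ_nsq hT hs
  have hi := int_log_le hT hl hs hu
  set Z := ZZ T lam (fun t => h t u)
  have hd0 : d ≠ 0 := by rw [hf]; exact Complex.exp_ne_zero _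
  have hcc : Continuous fun r => 2 / (Z r * Z r) :=
    Continuous.div continuous_const (hc.mul hc) fun s => mul_ne_zero (hne s) (hne s)
  have hlog : Real.log ‖d‖ = ∫ r in (0:ℝ)..T, (2 / (Z r * Z r)).re := by
    rw [hf, Complex.norm_exp, Real.log_exp]
    exact (Complex.reCLM.intervalIntegral_comp_comm (hcc.intervalIntegrable _ _)).symm
  have hpt : ∀ r, PP (Z r) ^ 2 = (2 / (Z r * Z r)).re + 2 / Complex.normSq (Z r) := by
    intro r
    have h0 := hns r
    have h1 := (Complex.normSq_apply (Z r))
    rw [PP, div_pow, mul_pow, sq_abs, Complex.div_re, Complex.normSq_mul]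
    simp only [Complex.mul_re, Complex.mul_im, Complex.re_ofNat, Complex.im_ofNat]
    field_simp
    rw [h1]
    ring
  simp_rw [hpt]
  rw [intervalIntegral.integral_add, ← hlog]
  · have hI : 0 < Real.sqrt (4 * T + u.im ^ 2) := by positivity
    have : Real.sqrt (4 * T + u.im ^ 2) * ‖d‖ / u.im = ‖d‖ * (Real.sqrt (4 * T + u.im ^ 2) / u.im) := by
      ring
    rw [this, Real.log_mul (norm_ne_zero_iff.2 hd0) (by positivity)]
    linarith
  · exact (Complex.continuous_re.comp hcc).intervalIntegrable _ _
  · exact (Continuous.div continuous_const (Complex.continuous_normSq.comp hc)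
      fun s => (hns s).ne').intervalIntegrable _ _

lemma main_cont
    (T : ℝ) (hT : 0 < T)
    (lam1 lam2 : ℝ → ℝ)
    (hl1 : Continuous lam1) (hl2 : Continuous lam2)
    (h1 h2 : ℝ → ℂ → ℂ)
    (hsol1 : ∀ z ∈ UHP, IsBwdSolOn lam1 z (fun t => h1 t z) T)
    (hsol2 : ∀ z ∈ UHP, IsBwdSolOn lam2 z (fun t => h2 t z) T)
    (u : ℂ) (hu : 0 < u.im)
    (d1 d2 : ℂ) (hd1 : HasDerivAt (h1 T) d1 u) (hd2 : HasDerivAt (h2 T) d2 u)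
    (ε : ℝ) (hε : ∀ s ∈ Icc (0:ℝ) T, |lam1 s - lam2 s| ≤ ε) :
    ‖h1 T u - h2 T u‖ ≤
      ε *
        Real.exp ((1/2) *
            Real.sqrt (Real.log (Real.sqrt (4 * T + u.im ^ 2) * ‖d1‖ / u.im) *
              Real.log (Real.sqrt (4 * T + u.im ^ 2) * ‖d2‖ / u.im))
          + Real.log (Real.log (Real.sqrt (4 * T + u.im ^ 2) / u.im))) := by
  have hTm : T ∈ Icc (0:ℝ) T := ⟨hT.le, le_rfl⟩
  have hε0 : 0 ≤ ε := (abs_nonneg _).trans (hε T hTm)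
  have hP1 := int_PP_le hT hl1 h1 hsol1 u hu d1 hd1
  have hP2 := int_PP_le hT hl2 h2 hsol2 u hu d2 hd2
  have hs1 := hsol1 u hu
  have hs2 := hsol2 u hu
  have hD := diff_eq hT hl1 hl2 hs1 hs2 hTm
  have hi1 := int_log_le hT hl1 hs1 hu
  have hi2 := int_log_le hT hl2 hs2 hu
  have hc1 := ZZ_cont hT hl1 hs1
  have hc2 := ZZ_cont hT hl2 hs2
  have hn1 := ZZ_ne hT hs1
  have hn2 := ZZ_ne hT hs2
  have hq1 := ZZ_nsq hT hs1
  have hq2 := ZZ_nsq hT hs2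
  have him1 := ZZ_im hT hs1
  have him2 := ZZ_im hT hs2
  set Z1 := ZZ T lam1 (fun t => h1 t u)
  set Z2 := ZZ T lam2 (fun t => h2 t u)
  set L1 := Real.log (Real.sqrt (4 * T + u.im ^ 2) * ‖d1‖ / u.im)
  set L2 := Real.log (Real.sqrt (4 * T + u.im ^ 2) * ‖d2‖ / u.im)
  have ha : Continuous fun r => 2 / (Z1 r * Z2 r) :=
    Continuous.div continuous_const (hc1.mul hc2) fun s => mul_ne_zero (hn1 s) (hn2 s)
  have hPc : ∀ Z : ℝ → ℂ, Continuous Z → (∀ s, 0 < Complex.normSq (Z s)) →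
      Continuous fun r => PP (Z r) := by
    intro Z hZ hq
    refine Continuous.div ?_ (Complex.continuous_normSq.comp hZ) fun s => (hq s).ne'
    have := Complex.continuous_re.comp hZ
    unfold Function.comp at this
    fun_prop
  have hPc1 := hPc Z1 hc1 hq1
  have hPc2 := hPc Z2 hc2 hq2
  have hPn : ∀ z, 0 ≤ PP z := fun z =>
    div_nonneg (by positivity) (Complex.normSq_nonneg _)
  set K := (1/2) * Real.sqrt (L1 * L2) with hK
  have hCS : ∫ r in (0:ℝ)..T, (1/2) * (PP (Z1 r) * PP (Z2 r)) ≤ K := by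
    rw [intervalIntegral.integral_const_mul]
    refine mul_le_mul_of_nonneg_left ?_ (by norm_num)
    refine (cauchy_schwarz_int _ _ hPc1 hPc2 T hT.le).trans (Real.sqrt_le_sqrt ?_)
    have n1 : 0 ≤ ∫ r in (0:ℝ)..T, PP (Z1 r) ^ 2 :=
      intervalIntegral.integral_nonneg hT.le fun _ _ => sq_nonneg _
    have n2 : 0 ≤ ∫ r in (0:ℝ)..T, PP (Z2 r) ^ 2 :=
      intervalIntegral.integral_nonneg hT.le fun _ _ => sq_nonneg _
    exact mul_le_mul hP1 hP2 n2 (n1.trans hP1)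
  have hre : ∀ r, (2 / (Z1 r * Z2 r)).re ≤ (1/2) * (PP (Z1 r) * PP (Z2 r)) := by
    intro r
    have e1 := hq1 r
    have e2 := hq2 r
    rw [PP, PP, Complex.div_re, Complex.normSq_mul]
    simp only [Complex.mul_re, Complex.mul_im, Complex.re_ofNat, Complex.im_ofNat]
    have k1 := mul_pos (him1 r) (him2 r)
    have k2 : (Z1 r).re * (Z2 r).re ≤ |(Z1 r).re| * |(Z2 r).re| := by
      rw [← abs_mul]; exact le_abs_self _
    have : (1/2 : ℝ) * (2 * |(Z1 r).re| / Complex.normSq (Z1 r) *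
        (2 * |(Z2 r).re| / Complex.normSq (Z2 r))) =
        2 * (|(Z1 r).re| * |(Z2 r).re|) / (Complex.normSq (Z1 r) * Complex.normSq (Z2 r)) := by
      field_simp
    rw [this, zero_mul, zero_div, add_zero]
    gcongr
    linarith
  have hexp : ∀ s ∈ Icc (0:ℝ) T, ‖Complex.exp (∫ r in s..T, 2 / (Z1 r * Z2 r))‖ ≤ Real.exp K := by
    intro s hs
    rw [Complex.norm_exp]
    apply Real.exp_le_exp.2
    have e1 : (∫ r in s..T, 2 / (Z1 r * Z2 r)).re = ∫ r in s..T, (2 / (Z1 r * Z2 r)).re :=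
      (Complex.reCLM.intervalIntegral_comp_comm (ha.intervalIntegrable _ _)).symm
    have e2 : ∫ r in s..T, (2 / (Z1 r * Z2 r)).re ≤ ∫ r in s..T, (1/2) * (PP (Z1 r) * PP (Z2 r)) :=
      intervalIntegral.integral_mono_on hs.2
        ((Complex.continuous_re.comp ha).intervalIntegrable _ _)
        (Continuous.intervalIntegrable (by fun_prop) _ _) (fun r _ => hre r)
    have e3 : ∫ r in s..T, (1/2) * (PP (Z1 r) * PP (Z2 r)) ≤
        ∫ r in (0:ℝ)..T, (1/2) * (PP (Z1 r) * PP (Z2 r)) := by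
      have n0 : 0 ≤ ∫ r in (0:ℝ)..s, (1/2) * (PP (Z1 r) * PP (Z2 r)) :=
        intervalIntegral.integral_nonneg hs.1 fun r _ =>
          mul_nonneg (by norm_num) (mul_nonneg (hPn _) (hPn _))
      have := intervalIntegral.integral_add_adjacent_intervals (μ := volume) (a := 0) (b := s) (c := T)
        (f := fun r => (1/2) * (PP (Z1 r) * PP (Z2 r)))
        (Continuous.intervalIntegrable (by fun_prop) _ _)
        (Continuous.intervalIntegrable (by fun_prop) _ _)
      linarith
    rw [e1]
    linarith
  set M := Real.log (Real.sqrt (4 * T + u.im ^ 2) / u.im) with hM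
  have hMpos : 0 < M := by
    apply Real.log_pos
    rw [one_lt_div hu]
    apply Real.lt_sqrt_of_sq_lt
    linarith
  have hqc1 : Continuous fun s => 2 / Complex.normSq (Z1 s) :=
    Continuous.div continuous_const (Complex.continuous_normSq.comp hc1) fun s => (hq1 s).ne'
  have hqc2 : Continuous fun s => 2 / Complex.normSq (Z2 s) :=
    Continuous.div continuous_const (Complex.continuous_normSq.comp hc2) fun s => (hq2 s).ne'
  have hpsi : ∀ s, ‖2 / (Z1 s * Z2 s)‖ ≤
      (1/2) * (2 / Complex.normSq (Z1 s) + 2 / Complex.normSq (Z2 s)) := by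
    intro s
    rw [norm_div, norm_mul, Complex.normSq_eq_norm_sq, Complex.normSq_eq_norm_sq]
    simp only [Complex.norm_ofNat]
    have p1 : 0 < ‖Z1 s‖ := norm_pos_iff.2 (hn1 s)
    have p2 : 0 < ‖Z2 s‖ := norm_pos_iff.2 (hn2 s)
    have : (1/2) * (2 / ‖Z1 s‖ ^ 2 + 2 / ‖Z2 s‖ ^ 2) - 2 / (‖Z1 s‖ * ‖Z2 s‖)
        = (1 / ‖Z1 s‖ - 1 / ‖Z2 s‖) ^ 2 := by
      field_simp
      ring
    nlinarith [sq_nonneg (1 / ‖Z1 s‖ - 1 / ‖Z2 s‖)]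
  have hfin : ‖h1 T u - h2 T u‖ ≤ ∫ s in (0:ℝ)..T, (Real.exp K * ε) *
      ((1/2) * (2 / Complex.normSq (Z1 s) + 2 / Complex.normSq (Z2 s))) := by
    rw [hD, sub_self, mul_zero, zero_add]
    refine intervalIntegral.norm_integral_le_of_norm_le hT.le ?_
      (Continuous.intervalIntegrable (by fun_prop) _ _)
    refine Eventually.of_forall fun s hs => ?_
    have hs' : s ∈ Icc (0:ℝ) T := ⟨hs.1.le, hs.2⟩
    rw [norm_mul, norm_mul, norm_neg, Complex.norm_real, Real.norm_eq_abs]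
    calc _ ≤ Real.exp K * (((1/2) * (2 / Complex.normSq (Z1 s) + 2 / Complex.normSq (Z2 s))) * ε) := by
          have := (norm_nonneg _).trans (hpsi s)
          exact mul_le_mul (hexp s hs') (mul_le_mul (hpsi s) (hε s hs') (abs_nonneg _) this)
            (by positivity) (Real.exp_pos _).le
      _ = _ := by ring
  rw [intervalIntegral.integral_const_mul, intervalIntegral.integral_const_mul,
    intervalIntegral.integral_add (hqc1.intervalIntegrable _ _) (hqc2.intervalIntegrable _ _)] at hfin
  rw [Real.exp_add, Real.exp_log hMpos]
  refine hfin.trans ?_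
  have : (1/2) * ((∫ s in (0:ℝ)..T, 2 / Complex.normSq (Z1 s)) +
      ∫ s in (0:ℝ)..T, 2 / Complex.normSq (Z2 s)) ≤ M := by linarith
  calc _ ≤ Real.exp K * ε * M := mul_le_mul_of_nonneg_left this (by positivity)
    _ = _ := by ring

lemma sol_congr {T : ℝ} {lam lam' : ℝ → ℝ} {z : ℂ} {h : ℝ → ℂ} (he : ∀ t ∈ Icc (0:ℝ) T, lam' t = lam t)
    (hs : IsBwdSolOn lam z h T) : IsBwdSolOn lam' z h T := by
  refine ⟨hs.1, fun t ht => ?_⟩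
  rw [he t ht]
  exact hs.2 t ht

end Helpers

/-- **Backward Loewner maps with close drivers are close** (Johansson Viklund–Rohde–Wong,
Lemma 2.3). Let `0 < T < ∞` and let `λ⁽¹⁾, λ⁽²⁾ : [0,T] → ℝ` be continuous drivers. For
`j = 1, 2` let `h⁽ʲ⁾_t(z)` solve the backward Loewner equation with driver `λ⁽ʲ⁾`, and
assume `z ↦ h⁽ʲ⁾_T(z)` is complex-differentiable at `u = x + iy ∈ ℍ`. With
`ε = sup_{s∈[0,T]} |λ⁽¹⁾_s − λ⁽²⁾_s|` and `I_{T,y} = √(4T + y²)`,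
`|h⁽¹⁾_T(u) − h⁽²⁾_T(u)| ≤ ε · exp[ ½ (log(I_{T,y}|(h⁽¹⁾_T)'(u)|/y) ·
  log(I_{T,y}|(h⁽²⁾_T)'(u)|/y))^{1/2} + log log(I_{T,y}/y) ]`. -/
theorem backward_loewner_uniform_close
    (T : ℝ) (hT : 0 < T)
    (lam1 lam2 : ℝ → ℝ)
    (hl1 : ContinuousOn lam1 (Set.Icc 0 T)) (hl2 : ContinuousOn lam2 (Set.Icc 0 T))
    (h1 h2 : ℝ → ℂ → ℂ)
    (hsol1 : ∀ z ∈ UHP, IsBwdSolOn lam1 z (fun t => h1 t z) T)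
    (hsol2 : ∀ z ∈ UHP, IsBwdSolOn lam2 z (fun t => h2 t z) T)
    (u : ℂ) (hu : 0 < u.im)
    (d1 d2 : ℂ) (hd1 : HasDerivAt (h1 T) d1 u) (hd2 : HasDerivAt (h2 T) d2 u) :
    ‖h1 T u - h2 T u‖ ≤
      sSup ((fun s => |lam1 s - lam2 s|) '' Set.Icc (0:ℝ) T) *
        Real.exp ((1/2) *
            Real.sqrt (Real.log (Real.sqrt (4 * T + u.im ^ 2) * ‖d1‖ / u.im) *
              Real.log (Real.sqrt (4 * T + u.im ^ 2) * ‖d2‖ / u.im))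
          + Real.log (Real.log (Real.sqrt (4 * T + u.im ^ 2) / u.im))) := by
  have hbdd : BddAbove ((fun s => |lam1 s - lam2 s|) '' Set.Icc (0:ℝ) T) :=
    (isCompact_Icc.image_of_continuousOn (hl1.sub hl2).abs).bddAbove
  have e : ∀ lam : ℝ → ℝ, ∀ t ∈ Icc (0:ℝ) T, lam (max 0 (min t T)) = lam t := by
    intro lam t ht
    rw [pr_eq ht]
  refine main_cont T hT (fun t => lam1 (max 0 (min t T))) (fun t => lam2 (max 0 (min t T)))
    (hl1.comp_continuous (by fun_prop) (pr_mem hT)) (hl2.comp_continuous (by fun_prop) (pr_mem hT))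
    h1 h2 (fun z hz => sol_congr (e lam1) (hsol1 z hz)) (fun z hz => sol_congr (e lam2) (hsol2 z hz))
    u hu d1 d2 hd1 hd2 _ ?_
  intro s hs
  simp only [e lam1 s hs, e lam2 s hs]
  exact le_csSup hbdd ⟨s, hs, rfl⟩

end
end

section
/- Let 0 < T < ∞, let λ^{(1)}, λ^{(2)} : [0,T] → ℝ be continuous, and for j = 1, 2 let h^{(j)}_t solve the backward Loewner equation with driver λ^{(j)} started from points u₁, u₂ ∈ ℍ respectively. Set z^{(j)}_s = h^{(j)}_s(u_j) − λ^{(j)}_s, ψ(s) = 2/(z^{(1)}_s z^{(2)}_s), u(s) = exp(−∫₀^s ψ(r) dr), and H(s) = h^{(1)}_s(u₁) − h^{(2)}_s(u₂). Then H satisfies the linear ODE Ḣ(s) − H(s)ψ(s) = (λ^{(2)}_s − λ^{(1)}_s)ψ(s), and consequently H(s) = u(s)^{−1} ( H(0) + ∫₀^s (λ^{(2)}_r − λ^{(1)}_r) u(r) ψ(r) dr ) for all s ∈ [0,T]. -/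
open MeasureTheory Filter Set

noncomputable section

/-- The function `ψ(s) = 2/(z⁽¹⁾_s z⁽²⁾_s)` where `z⁽ʲ⁾_s = h⁽ʲ⁾_s − λ⁽ʲ⁾_s`. -/
def bwdPsi (lam1 lam2 : ℝ → ℝ) (h1 h2 : ℝ → ℂ) (s : ℝ) : ℂ :=
  2 / ((h1 s - (lam1 s : ℂ)) * (h2 s - (lam2 s : ℂ)))

/-- The integrating factor `u(s) = exp(−∫₀ˢ ψ(r) dr)`. -/
def bwdU (lam1 lam2 : ℝ → ℝ) (h1 h2 : ℝ → ℂ) (s : ℝ) : ℂ :=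
  Complex.exp (-(∫ r in (0:ℝ)..s, bwdPsi lam1 lam2 h1 h2 r))

/-- **The difference of two backward Loewner flows solves a linear ODE** and is given by the
variation-of-constants formula. With `H(s) = h⁽¹⁾_s(u₁) − h⁽²⁾_s(u₂)`,
`z⁽ʲ⁾_s = h⁽ʲ⁾_s(u_j) − λ⁽ʲ⁾_s`, `ψ(s) = 2/(z⁽¹⁾_s z⁽²⁾_s)` and `u(s) = exp(−∫₀ˢ ψ)`:
`Ḣ(s) − H(s)ψ(s) = (λ⁽²⁾_s − λ⁽¹⁾_s)ψ(s)` and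
`H(s) = u(s)⁻¹ (H(0) + ∫₀ˢ (λ⁽²⁾_r − λ⁽¹⁾_r) u(r) ψ(r) dr)` for all `s ∈ [0,T]`. -/
theorem backward_loewner_difference_ode
    (T : ℝ) (hT : 0 < T)
    (lam1 lam2 : ℝ → ℝ)
    (hl1 : ContinuousOn lam1 (Set.Icc 0 T)) (hl2 : ContinuousOn lam2 (Set.Icc 0 T))
    (u₁ u₂ : ℂ) (hu₁ : u₁ ∈ UHP) (hu₂ : u₂ ∈ UHP)
    (h1 h2 : ℝ → ℂ)
    (hsol1 : IsBwdSolOn lam1 u₁ h1 T) (hsol2 : IsBwdSolOn lam2 u₂ h2 T) :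
    ∀ s ∈ Set.Icc (0:ℝ) T,
      HasDerivAt (fun r => h1 r - h2 r)
          ((h1 s - h2 s) * bwdPsi lam1 lam2 h1 h2 s
            + ((lam2 s : ℂ) - (lam1 s : ℂ)) * bwdPsi lam1 lam2 h1 h2 s) s ∧
      h1 s - h2 s =
        (bwdU lam1 lam2 h1 h2 s)⁻¹ *
          ((h1 0 - h2 0) +
            ∫ r in (0:ℝ)..s,
              ((lam2 r : ℂ) - (lam1 r : ℂ)) * bwdU lam1 lam2 h1 h2 r
                * bwdPsi lam1 lam2 h1 h2 r) := by
  have hz : ∀ (lam : ℝ → ℝ) (z : ℂ) (h : ℝ → ℂ), IsBwdSolOn lam z h T →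
      ∀ t ∈ Set.Icc (0:ℝ) T, h t - (lam t : ℂ) ≠ 0 := by
    intro lam z h hs t ht h0
    have h3 := (hs.2 t ht).1
    have h4 := congrArg Complex.im h0
    simp at h4
    linarith
  have hz1 := hz _ _ _ hsol1
  have hz2 := hz _ _ _ hsol2
  have hc1 : ContinuousOn h1 (Set.Icc 0 T) := fun t ht =>
    (hsol1.2 t ht).2.continuousAt.continuousWithinAt
  have hc2 : ContinuousOn h2 (Set.Icc 0 T) := fun t ht =>
    (hsol2.2 t ht).2.continuousAt.continuousWithinAt
  have hL1 : ContinuousOn (fun t => (lam1 t : ℂ)) (Set.Icc 0 T) :=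
    Complex.continuous_ofReal.comp_continuousOn hl1
  have hL2 : ContinuousOn (fun t => (lam2 t : ℂ)) (Set.Icc 0 T) :=
    Complex.continuous_ofReal.comp_continuousOn hl2
  have hpsi : ContinuousOn (bwdPsi lam1 lam2 h1 h2) (Set.Icc 0 T) := by
    unfold bwdPsi
    exact continuousOn_const.div ((hc1.sub hL1).mul (hc2.sub hL2))
      (fun t ht => mul_ne_zero (hz1 t ht) (hz2 t ht))
  have hder : ∀ s ∈ Set.Icc (0:ℝ) T, HasDerivAt (fun r => h1 r - h2 r)
          ((h1 s - h2 s) * bwdPsi lam1 lam2 h1 h2 s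
            + ((lam2 s : ℂ) - (lam1 s : ℂ)) * bwdPsi lam1 lam2 h1 h2 s) s := by
    intro s hs
    refine ((hsol1.2 s hs).2.sub (hsol2.2 s hs).2).congr_deriv ?_
    have a1 := hz1 s hs
    have a2 := hz2 s hs
    unfold bwdPsi
    field_simp
    ring
  have hint : IntervalIntegrable (bwdPsi lam1 lam2 h1 h2) volume 0 T :=
    ContinuousOn.intervalIntegrable (by rwa [Set.uIcc_of_le hT.le])
  have hUc : ContinuousOn (bwdU lam1 lam2 h1 h2) (Set.Icc 0 T) := by
    have h3 := intervalIntegral.continuousOn_primitive_interval' hint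
      (Set.left_mem_uIcc)
    rw [Set.uIcc_of_le hT.le] at h3
    exact Complex.continuous_exp.comp_continuousOn h3.neg
  have hUd : ∀ s ∈ Set.Ioo (0:ℝ) T, HasDerivAt (bwdU lam1 lam2 h1 h2)
      (bwdU lam1 lam2 h1 h2 s * (-(bwdPsi lam1 lam2 h1 h2 s))) s := by
    intro s hs
    have hn : Set.Icc (0:ℝ) T ∈ nhds s := Icc_mem_nhds hs.1 hs.2
    have h3 : HasDerivAt (fun x => ∫ r in (0:ℝ)..x, bwdPsi lam1 lam2 h1 h2 r)
        (bwdPsi lam1 lam2 h1 h2 s) s := by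
      apply intervalIntegral.integral_hasDerivAt_right
      · apply hint.mono_set
        rw [Set.uIcc_of_le hT.le, Set.uIcc_of_le hs.1.le]
        exact Set.Icc_subset_Icc_right hs.2.le
      · exact (hpsi.mono Set.Ioo_subset_Icc_self).stronglyMeasurableAtFilter isOpen_Ioo s hs
      · exact hpsi.continuousAt hn
    exact h3.neg.cexp
  intro s hs
  refine ⟨hder s hs, ?_⟩
  have hsub : Set.Icc 0 s ⊆ Set.Icc 0 T := Set.Icc_subset_Icc_right hs.2
  have key : ∫ r in (0:ℝ)..s, ((lam2 r : ℂ) - (lam1 r : ℂ)) * bwdU lam1 lam2 h1 h2 r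
                * bwdPsi lam1 lam2 h1 h2 r
      = bwdU lam1 lam2 h1 h2 s * (h1 s - h2 s) - bwdU lam1 lam2 h1 h2 0 * (h1 0 - h2 0) := by
    apply intervalIntegral.integral_eq_sub_of_hasDerivAt_of_le hs.1
      (f := fun r => bwdU lam1 lam2 h1 h2 r * (h1 r - h2 r))
    · exact (hUc.mul (hc1.sub hc2)).mono hsub
    · intro r hr
      have hr' : r ∈ Set.Ioo (0:ℝ) T := ⟨hr.1, hr.2.trans_le hs.2⟩
      refine ((hUd r hr').mul (hder r (Set.Ioo_subset_Icc_self hr'))).congr_deriv ?_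
      ring
    · apply ContinuousOn.intervalIntegrable
      rw [Set.uIcc_of_le hs.1]
      exact (((hL2.sub hL1).mul hUc).mul hpsi).mono hsub
  have hU0 : bwdU lam1 lam2 h1 h2 0 = 1 := by simp [bwdU]
  have hUs : bwdU lam1 lam2 h1 h2 s ≠ 0 := Complex.exp_ne_zero _
  rw [key, hU0]
  field_simp
  ring

end
end

section
/- Let 0 < T < ∞, let λ^{(1)}, λ^{(2)} : [0,T] → ℝ be continuous, let u₁, u₂ ∈ ℍ with Im u₁ = Im u₂ = y > 0, and for j = 1, 2 let h^{(j)}_t solve the backward Loewner equation with driver λ^{(j)} started from u_j. With z^{(j)}_s = h^{(j)}_s(u_j) − λ^{(j)}_s and ψ(s) = 2/(z^{(1)}_s z^{(2)}_s), one has |exp( ∫₀^s ψ(r) dr )| ≤ √(4s + y²) / y for every s ∈ [0,T]. -/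
open MeasureTheory Filter Set

noncomputable section

lemma bwd_aux (T : ℝ) (lam : ℝ → ℝ) (hl : ContinuousOn lam (Set.Icc 0 T)) (u : ℂ)
    (hu : 0 < u.im) (h : ℝ → ℂ) (hsol : IsBwdSolOn lam u h T) :
    ContinuousOn (fun t => h t - (lam t : ℂ)) (Set.Icc 0 T) ∧
    (∀ t ∈ Set.Icc (0:ℝ) T, h t - (lam t : ℂ) ≠ 0) ∧
    ∀ s ∈ Set.Icc (0:ℝ) T,
      (∫ r in (0:ℝ)..s, 1 / ‖h r - (lam r : ℂ)‖ ^ 2)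
        = (Real.log (h s).im - Real.log u.im) / 2 ∧
      (h s).im ^ 2 ≤ 4 * s + u.im ^ 2 := by
  obtain ⟨h0, hs⟩ := hsol
  have hc : ContinuousOn (fun t => h t - (lam t : ℂ)) (Set.Icc 0 T) := by
    apply ContinuousOn.sub
    · intro t ht
      exact (hs t ht).2.continuousAt.continuousWithinAt
    · exact Complex.continuous_ofReal.comp_continuousOn hl
  have hne : ∀ t ∈ Set.Icc (0:ℝ) T, h t - (lam t : ℂ) ≠ 0 := by
    intro t ht h
    have := congrArg Complex.im h
    simp at this
    exact (hs t ht).1.ne' this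
  have hd : ∀ t ∈ Set.Icc (0:ℝ) T, HasDerivAt (fun t => (h t).im)
      (2 * (h t).im * (1 / ‖h t - (lam t : ℂ)‖ ^ 2)) t := by
    intro t ht
    have := Complex.imCLM.hasFDerivAt.comp_hasDerivAt t (hs t ht).2
    refine this.congr_deriv ?_
    simp only [Complex.imCLM_apply, Complex.div_im, Complex.sq_norm]
    simp
    ring
  refine ⟨hc, hne, fun s hsT => ?_⟩
  have hsub : Set.Icc 0 s ⊆ Set.Icc 0 T := Set.Icc_subset_Icc_right hsT.2
  have hcg : ContinuousOn (fun r => 1 / ‖h r - (lam r : ℂ)‖ ^ 2) (Set.Icc 0 T) :=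
    continuousOn_const.div (hc.norm.pow 2) (fun t ht => by
      have := hne t ht
      positivity)
  constructor
  · rw [intervalIntegral.integral_eq_sub_of_hasDerivAt
      (f := fun t => Real.log (h t).im / 2)]
    · simp only [h0]; ring
    · intro t ht
      rw [Set.uIcc_of_le hsT.1] at ht
      have hp := (hs t (hsub ht)).1
      refine (((hd t (hsub ht)).log hp.ne').div_const 2).congr_deriv ?_
      field_simp
    · apply ContinuousOn.intervalIntegrable
      rw [Set.uIcc_of_le hsT.1]
      exact hcg.mono hsub
  · have hd2 : ∀ t ∈ Set.Icc (0:ℝ) T, HasDerivAt (fun t => (h t).im ^ 2 - 4 * t)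
        (2 * (h t).im * (2 * (h t).im * (1 / ‖h t - (lam t : ℂ)‖ ^ 2)) - 4) t := by
      intro t ht
      refine (((hd t ht).pow 2).sub ((hasDerivAt_id t).const_mul 4)).congr_deriv ?_
      simp
    have hanti : AntitoneOn (fun t => (h t).im ^ 2 - 4 * t) (Set.Icc 0 T) := by
      apply antitoneOn_of_deriv_nonpos (convex_Icc 0 T)
      · intro t ht
        exact (hd2 t ht).continuousAt.continuousWithinAt
      · intro t ht
        exact (hd2 t (interior_subset ht)).differentiableAt.differentiableWithinAt
      · intro t ht
        have ht := interior_subset ht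
        rw [(hd2 t ht).deriv]
        have hp : 0 < ‖h t - (lam t : ℂ)‖ := norm_pos_iff.2 (hne t ht)
        have hle : |(h t).im| ≤ ‖h t - (lam t : ℂ)‖ := by
          simpa using Complex.abs_im_le_norm (h t - (lam t : ℂ))
        have h3 : (h t).im ^ 2 ≤ ‖h t - (lam t : ℂ)‖ ^ 2 := by
          rw [← sq_abs]; gcongr
        have h4 : (h t).im ^ 2 / ‖h t - (lam t : ℂ)‖ ^ 2 ≤ 1 :=
          (div_le_one (by positivity)).2 h3
        have h5 : 2 * (h t).im * (2 * (h t).im * (1 / ‖h t - (lam t : ℂ)‖ ^ 2))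
          = 4 * ((h t).im ^ 2 / ‖h t - (lam t : ℂ)‖ ^ 2) := by ring
        linarith
    have := hanti (Set.left_mem_Icc.2 (hsT.1.trans hsT.2)) hsT hsT.1
    simp only [h0] at this
    linarith

/-- **Bound on the integrating factor.** Let `λ⁽¹⁾, λ⁽²⁾ : [0,T] → ℝ` be continuous, let
`u₁, u₂ ∈ ℍ` with `Im u₁ = Im u₂ = y > 0`, and let `h⁽ʲ⁾` solve the backward Loewner
equation with driver `λ⁽ʲ⁾` started from `u_j`. With `z⁽ʲ⁾_s = h⁽ʲ⁾_s − λ⁽ʲ⁾_s` and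
`ψ(s) = 2/(z⁽¹⁾_s z⁽²⁾_s)`, one has `|exp(∫₀ˢ ψ(r) dr)| ≤ √(4s + y²)/y` for `s ∈ [0,T]`. -/
theorem backward_loewner_integrating_factor_bound
    (T : ℝ) (hT : 0 < T)
    (lam1 lam2 : ℝ → ℝ)
    (hl1 : ContinuousOn lam1 (Set.Icc 0 T)) (hl2 : ContinuousOn lam2 (Set.Icc 0 T))
    (u₁ u₂ : ℂ) (hy : 0 < u₁.im) (him : u₁.im = u₂.im)
    (h1 h2 : ℝ → ℂ)
    (hsol1 : IsBwdSolOn lam1 u₁ h1 T) (hsol2 : IsBwdSolOn lam2 u₂ h2 T) :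
    ∀ s ∈ Set.Icc (0:ℝ) T,
      ‖Complex.exp (∫ r in (0:ℝ)..s, bwdPsi lam1 lam2 h1 h2 r)‖
        ≤ Real.sqrt (4 * s + u₁.im ^ 2) / u₁.im := by
  intro s hs
  obtain ⟨hc1, hn1, H1⟩ := bwd_aux T lam1 hl1 u₁ hy h1 hsol1
  obtain ⟨hc2, hn2, H2⟩ := bwd_aux T lam2 hl2 u₂ (him ▸ hy) h2 hsol2
  obtain ⟨I1, B1⟩ := H1 s hs
  obtain ⟨I2, B2⟩ := H2 s hs
  have p1 := (hsol1.2 s hs).1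
  have p2 := (hsol2.2 s hs).1
  rw [← him] at I2 B2
  have hsub : Set.Icc 0 s ⊆ Set.Icc 0 T := Set.Icc_subset_Icc_right hs.2
  have hi : ∀ (lam : ℝ → ℝ) (h : ℝ → ℂ),
      ContinuousOn (fun t => h t - (lam t : ℂ)) (Set.Icc 0 T) →
      (∀ t ∈ Set.Icc (0:ℝ) T, h t - (lam t : ℂ) ≠ 0) →
      IntervalIntegrable (fun r => 1 / ‖h r - (lam r : ℂ)‖ ^ 2) volume 0 s := by
    intro lam h hc hn
    apply ContinuousOn.intervalIntegrable
    rw [Set.uIcc_of_le hs.1]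
    exact (continuousOn_const.div (hc.norm.pow 2) (fun t ht =>
      pow_ne_zero 2 (norm_ne_zero_iff.2 (hn t ht)))).mono hsub
  have i1 := hi lam1 h1 hc1 hn1
  have i2 := hi lam2 h2 hc2 hn2
  have hb : ‖∫ r in (0:ℝ)..s, bwdPsi lam1 lam2 h1 h2 r‖ ≤
      ∫ r in (0:ℝ)..s, (1 / ‖h1 r - (lam1 r : ℂ)‖ ^ 2 + 1 / ‖h2 r - (lam2 r : ℂ)‖ ^ 2) := by
    apply intervalIntegral.norm_integral_le_of_norm_le hs.1 _ (i1.add i2)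
    refine Filter.Eventually.of_forall fun t _ => ?_
    simp only [bwdPsi, norm_div, norm_mul, Complex.norm_ofNat]
    have := two_mul_le_add_sq (1 / ‖h1 t - (lam1 t : ℂ)‖) (1 / ‖h2 t - (lam2 t : ℂ)‖)
    calc _ = 2 * (1 / ‖h1 t - (lam1 t : ℂ)‖) * (1 / ‖h2 t - (lam2 t : ℂ)‖) := by
          rw [div_eq_mul_inv, mul_inv]; ring
      _ ≤ _ := this
      _ = _ := by rw [div_pow, div_pow, one_pow]
  rw [intervalIntegral.integral_add i1 i2, I1, I2] at hb
  set A := Real.sqrt (4 * s + u₁.im ^ 2) with hA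
  have hApos : 0 < A := Real.sqrt_pos.2 (by have := hs.1; positivity)
  have a1 : Real.log (h1 s).im ≤ Real.log A := Real.log_le_log p1 (Real.le_sqrt_of_sq_le B1)
  have a2 : Real.log (h2 s).im ≤ Real.log A := Real.log_le_log p2 (Real.le_sqrt_of_sq_le B2)
  rw [Complex.norm_exp, ← Real.le_log_iff_exp_le (by positivity),
    Real.log_div hApos.ne' hy.ne']
  have := Complex.re_le_norm (∫ r in (0:ℝ)..s, bwdPsi lam1 lam2 h1 h2 r)
  linarith

end
end

section
/- Let λ : [0,1] → ℝ be continuous and suppose there is a subpower function φ with osc(λ, δ) ≤ √δ · φ(1/δ) for all δ ∈ (0,1]. Let λⁿ be the square-root interpolation of λ with n ≥ 1 subintervals. Then sup_{t∈[0,1]} |λⁿ(t) − λ(t)| ≤ 2 φ(n)/√n. -/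
open Filter Set

noncomputable section

/-- The piecewise square-root interpolation `λⁿ` of a driver `lam`, with nodes `t_k = k/n`:
on `[t_k, t_{k+1}]` it equals `√n (λ(t_{k+1}) - λ(t_k)) √(t - t_k) + λ(t_k)`. -/
def sqrtInterp (lam : ℝ → ℝ) (n : ℕ) (t : ℝ) : ℝ :=
  Real.sqrt n * (lam (((⌊t * (n:ℝ)⌋₊ : ℝ) + 1) / n) - lam ((⌊t * (n:ℝ)⌋₊ : ℝ) / n)) *
      Real.sqrt (t - (⌊t * (n:ℝ)⌋₊ : ℝ) / n) + lam ((⌊t * (n:ℝ)⌋₊ : ℝ) / n)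

/-- **Uniform distance between a weakly Hölder-1/2 driver and its square-root
interpolation.** If `osc(λ, δ) ≤ √δ·φ(1/δ)` for all `δ ∈ (0,1]` with `φ` a subpower
function, and `λⁿ` is the square-root interpolation of `λ` with `n ≥ 1` subintervals, then
`sup_{t∈[0,1]} |λⁿ(t) − λ(t)| ≤ 2 φ(n)/√n`. -/
theorem sqrt_interpolation_uniform_distance
    (lam : ℝ → ℝ) (hcont : ContinuousOn lam (Set.Icc 0 1))
    (φ : ℝ → ℝ) (hφ : IsSubpower φ)
    (hosc : ∀ δ ∈ Set.Ioc (0:ℝ) 1, osc lam δ ≤ Real.sqrt δ * φ (1/δ))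
    (n : ℕ) (hn : 1 ≤ n) :
    ∀ t ∈ Set.Icc (0:ℝ) 1, |sqrtInterp lam n t - lam t| ≤ 2 * φ n / Real.sqrt n := by
  intro t ht
  have hn0 : (0:ℝ) < n := by exact_mod_cast hn
  have hn1 : (1:ℝ) ≤ n := by exact_mod_cast hn
  have hsn : 0 < Real.sqrt n := Real.sqrt_pos.mpr hn0
  obtain ⟨C, hC⟩ := isCompact_Icc.exists_bound_of_continuousOn hcont
  have key : ∀ s ∈ Set.Icc (0:ℝ) 1, ∀ u ∈ Set.Icc (0:ℝ) 1, |u - s| ≤ 1 / n →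
      |lam u - lam s| ≤ φ n / Real.sqrt n := by
    intro s hs u hu hsu
    have h1 : |lam u - lam s| ≤ osc lam (1 / n) := by
      apply le_csSup
      · refine ⟨C + C, ?_⟩
        rintro d ⟨a, ha, b, hb, -, rfl⟩
        exact (norm_sub_le (lam b) (lam a)).trans (add_le_add (hC b hb) (hC a ha))
      · exact ⟨s, hs, u, hu, hsu, rfl⟩
    have h2 := hosc (1 / n) ⟨by positivity, by rw [div_le_one hn0]; exact hn1⟩
    rw [one_div_one_div, Real.sqrt_div zero_le_one, Real.sqrt_one] at h2
    calc _ ≤ _ := h1.trans h2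
      _ = _ := by ring
  have htn : 0 ≤ t * n := mul_nonneg ht.1 hn0.le
  have hf1 := Nat.floor_le htn
  have hf2 := Nat.lt_floor_add_one (t * (n:ℝ))
  unfold sqrtInterp
  generalize ⌊t * (n:ℝ)⌋₊ = k at *
  have hk0 : (0:ℝ) ≤ (k:ℝ) / n := by positivity
  have hkt : (k:ℝ) / n ≤ t := by rw [div_le_iff₀ hn0]; exact hf1
  have htk : t < ((k:ℝ) + 1) / n := by rw [lt_div_iff₀ hn0]; exact hf2
  have hd : ((k:ℝ) + 1) / n = k / n + 1 / n := add_div _ _ _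
  have hin : (0:ℝ) < 1 / n := by positivity
  have hkI : (k:ℝ) / n ∈ Set.Icc (0:ℝ) 1 := ⟨hk0, hkt.trans ht.2⟩
  have hB : |lam ((k:ℝ) / n) - lam t| ≤ φ n / Real.sqrt n :=
    key t ht _ hkI (by rw [abs_le]; constructor <;> linarith)
  have hA : |Real.sqrt n * (lam (((k:ℝ) + 1) / n) - lam ((k:ℝ) / n)) *
      Real.sqrt (t - (k:ℝ) / n)| ≤ φ n / Real.sqrt n := by
    have hnn : 0 ≤ φ n / Real.sqrt n := div_nonneg (hφ.1 _) hsn.le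
    by_cases hk : k + 1 ≤ n
    · have hk' : (k:ℝ) + 1 ≤ n := by exact_mod_cast hk
      have h1 := key _ hkI (((k:ℝ) + 1) / n)
        ⟨by linarith, by rw [div_le_one hn0]; exact hk'⟩
        (by rw [hd, add_sub_cancel_left, abs_of_pos hin])
      have h2 : Real.sqrt n * Real.sqrt (t - (k:ℝ) / n) ≤ 1 := by
        rw [← Real.sqrt_mul hn0.le, Real.sqrt_le_iff, one_pow, mul_sub, mul_div_cancel₀ _ hn0.ne']
        exact ⟨zero_le_one, by linarith⟩
      have h3 : 0 ≤ Real.sqrt n * Real.sqrt (t - (k:ℝ) / n) := by positivity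
      rw [mul_right_comm, abs_mul, abs_of_nonneg h3]
      exact (mul_le_of_le_one_left (abs_nonneg _) h2).trans h1
    · have hk' : (n:ℝ) ≤ k := by exact_mod_cast (by omega : n ≤ k)
      have h1 : (1:ℝ) ≤ k / n := by rw [le_div_iff₀ hn0]; linarith
      rw [Real.sqrt_eq_zero_of_nonpos (by linarith [ht.2] : t - (k:ℝ) / n ≤ 0), mul_zero, abs_zero]
      exact hnn
  rw [add_sub_assoc]
  calc _ ≤ _ := abs_add_le _ _
    _ ≤ _ := add_le_add hA hB
    _ = _ := by ring

end
end

section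
/- Let f : ℍ → ℂ be holomorphic and injective on the upper half-plane ℍ. Then for all z, w ∈ ℍ, |f(z) − f(w)| ≤ 2 (Im z) |f'(z)| · exp( 4 d_{ℍ,hyp}(z, w) ), where d_{ℍ,hyp}(z, w) = arccosh( 1 + |z − w|²/(2 Im z · Im w) ) is the hyperbolic distance in ℍ. -/
open Set

noncomputable section

/-- The inverse hyperbolic cosine, `arcosh x = log (x + √(x² − 1))`. -/
def arcoshReal (x : ℝ) : ℝ := Real.log (x + Real.sqrt (x ^ 2 - 1))

/-- The hyperbolic distance in the upper half-plane:
`d_{ℍ,hyp}(z,w) = arccosh(1 + |z − w|²/(2 Im z · Im w))`. -/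
def hypDist (z w : ℂ) : ℝ := arcoshReal (1 + ‖z - w‖ ^ 2 / (2 * z.im * w.im))


lemma kd_polar (G : ℂ → ENNReal) (hG : Measurable G) :
    ∫⁻ z, G z = ∫⁻ r in Ioi (0:ℝ), ∫⁻ θ in Ioo (-Real.pi) Real.pi,
      ENNReal.ofReal r * G (circleMap 0 r θ) := by
  rw [← Complex.lintegral_comp_polarCoord_symm]
  have h1 : polarCoord.target = Ioi (0:ℝ) ×ˢ Ioo (-Real.pi) Real.pi := rfl
  rw [h1, MeasureTheory.Measure.volume_eq_prod, ← MeasureTheory.Measure.prod_restrict,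
    MeasureTheory.lintegral_prod]
  · refine MeasureTheory.lintegral_congr fun r => MeasureTheory.lintegral_congr fun θ => ?_
    simp [circleMap, Complex.exp_mul_I]
  · refine Measurable.aemeasurable ?_
    simp only [Complex.polarCoord_symm_apply, smul_eq_mul]
    fun_prop

lemma kd_polar_ring (F : ℂ → ENNReal) (a b : ℝ) (ha : 0 < a)
    (hF : Measurable (indicator {z : ℂ | a < ‖z‖ ∧ ‖z‖ < b} F)) :
    ∫⁻ z in {z : ℂ | a < ‖z‖ ∧ ‖z‖ < b}, F z = ∫⁻ r in Ioo a b, ∫⁻ θ in Ioo (-Real.pi) Real.pi,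
      ENNReal.ofReal r * F (circleMap 0 r θ) := by
  have hm : MeasurableSet {z : ℂ | a < ‖z‖ ∧ ‖z‖ < b} :=
    (measurableSet_lt measurable_const measurable_norm).inter
      (measurableSet_lt measurable_norm measurable_const)
  rw [← MeasureTheory.lintegral_indicator hm, kd_polar _ hF,
    ← MeasureTheory.lintegral_indicator measurableSet_Ioi,
    ← MeasureTheory.lintegral_indicator measurableSet_Ioo]
  refine MeasureTheory.lintegral_congr fun r => ?_
  by_cases h : r ∈ Ioo a b
  · have h0 : r ∈ Ioi (0:ℝ) := ha.trans h.1
    rw [indicator_of_mem h, indicator_of_mem h0]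
    refine MeasureTheory.lintegral_congr fun θ => ?_
    rw [indicator_of_mem]
    have : |r| = r := abs_of_pos h0
    simpa [this] using h
  · rw [indicator_of_notMem h]
    by_cases h0 : r ∈ Ioi (0:ℝ)
    · rw [indicator_of_mem h0]
      have : |r| = r := abs_of_pos h0
      rw [MeasureTheory.lintegral_eq_zero_of_ae_eq_zero]
      refine Filter.Eventually.of_forall fun θ => ?_
      have h' : circleMap 0 r θ ∉ {z : ℂ | a < ‖z‖ ∧ ‖z‖ < b} := by simpa [this] using h
      simp only [indicator_of_notMem h', mul_zero, Pi.zero_apply]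
    · rw [indicator_of_notMem h0]

lemma kd_lint_inv (a b c : ℝ) (ha : 0 < a) (hab : a ≤ b) (hc : 0 ≤ c) :
    ∫⁻ r in Ioo a b, ENNReal.ofReal (c / r) = ENNReal.ofReal (c * Real.log (b / a)) := by
  rw [MeasureTheory.setLIntegral_congr MeasureTheory.Ioo_ae_eq_Ioc]
  have h0 : (0:ℝ) ∉ uIcc a b := by
    rw [uIcc_of_le hab]; intro h; exact absurd h.1 (not_le.2 ha)
  rw [← MeasureTheory.ofReal_integral_eq_lintegral_ofReal]
  · rw [← intervalIntegral.integral_of_le hab]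
    simp_rw [div_eq_mul_inv c]
    rw [intervalIntegral.integral_const_mul, integral_inv h0]
  · have : IntervalIntegrable (fun r : ℝ => c / r) MeasureTheory.volume a b := by
      simp_rw [div_eq_mul_inv c]
      exact (intervalIntegral.intervalIntegrable_inv (fun x hx => fun h => h0 (h ▸ hx))
        continuousOn_id).const_mul c
    exact (intervalIntegrable_iff_integrableOn_Ioc_of_le hab).1 this
  · filter_upwards [MeasureTheory.ae_restrict_mem measurableSet_Ioc] with r hr
    have := ha.trans hr.1
    simp only [Pi.zero_apply]; positivity

lemma kd_ring_area (a b : ℝ) (ha : 0 < a) (hab : a ≤ b) :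
    ∫⁻ z in {z : ℂ | a < ‖z‖ ∧ ‖z‖ < b}, ENNReal.ofReal ((‖z‖ ^ 2)⁻¹)
      = ENNReal.ofReal (2 * Real.pi * Real.log (b / a)) := by
  have hm : MeasurableSet {z : ℂ | a < ‖z‖ ∧ ‖z‖ < b} :=
    (measurableSet_lt measurable_const measurable_norm).inter
      (measurableSet_lt measurable_norm measurable_const)
  rw [kd_polar_ring _ a b ha, ← kd_lint_inv a b _ ha hab (by positivity)]
  · refine MeasureTheory.setLIntegral_congr_fun measurableSet_Ioo fun r hr => ?_
    have hr0 : 0 < r := ha.trans hr.1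
    have : |r| = r := abs_of_pos hr0
    simp only [norm_circleMap_zero, this, MeasureTheory.lintegral_const]
    rw [MeasureTheory.Measure.restrict_apply_univ, Real.volume_Ioo,
      ← ENNReal.ofReal_mul hr0.le, ← ENNReal.ofReal_mul (by positivity)]
    congr 1
    field_simp; ring
  · exact Measurable.indicator (by fun_prop) hm

/-- lower bound for logarithmic area -/
lemma kd_circle (q : ℂ → ℂ) (hq : DifferentiableOn ℂ q (Metric.ball 0 1)) (h0 : q 0 = 1)
    (r : ℝ) (hr : 0 < r) (hr1 : r < 1) :
    ENNReal.ofReal (2 * Real.pi / r) ≤ ∫⁻ θ in Ioo (-Real.pi) Real.pi,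
      ENNReal.ofReal r * ENNReal.ofReal (‖q (circleMap 0 r θ)‖ ^ 2 / r ^ 2) := by
  have hav : Real.circleAverage q 0 r = 1 := by
    rw [← h0]
    refine DiffContOnCl.circleAverage ?_
    rw [abs_of_pos hr]
    refine DifferentiableOn.diffContOnCl (hq.mono ?_)
    refine Metric.closure_ball_subset_closedBall.trans ?_
    exact Metric.closedBall_subset_ball hr1
  have hcont : Continuous fun θ : ℝ => q (circleMap 0 r θ) := by
    refine hq.continuousOn.comp_continuous (continuous_circleMap 0 r) fun θ => ?_
    simpa [abs_of_pos hr] using hr1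
  have hc1 : Continuous fun θ : ℝ => (q (circleMap 0 r θ)).re := Complex.continuous_re.comp hcont
  have hc2 : Continuous fun θ : ℝ => ‖q (circleMap 0 r θ)‖ ^ 2 / r :=
    (hcont.norm.pow 2).div_const r
  have hper : Function.Periodic (fun θ : ℝ => q (circleMap 0 r θ)) (2 * Real.pi) := by
    intro θ; simp only [periodic_circleMap 0 r θ]
  have hint : ∫ θ in (-Real.pi)..Real.pi, q (circleMap 0 r θ) = 2 * Real.pi := by
    have h1 := hper.intervalIntegral_add_eq (-Real.pi) 0
    rw [show -Real.pi + 2 * Real.pi = Real.pi by ring, zero_add] at h1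
    rw [h1]
    rw [Real.circleAverage_def] at hav
    have hpi : (Real.pi : ℂ) ≠ 0 := by exact_mod_cast Real.pi_ne_zero
    simp only [Complex.real_smul] at hav
    push_cast at hav
    field_simp at hav
    linear_combination hav
  have hre : ∫ θ in (-Real.pi)..Real.pi, (q (circleMap 0 r θ)).re = 2 * Real.pi := by
    have h2 := Complex.reCLM.intervalIntegral_comp_comm
      (hcont.intervalIntegrable (μ := MeasureTheory.volume) (-Real.pi) Real.pi)
    rw [hint] at h2
    simpa using h2
  have hle : 2 * Real.pi / r ≤ ∫ θ in (-Real.pi)..Real.pi, ‖q (circleMap 0 r θ)‖ ^ 2 / r := by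
    have h3 : ∫ θ in (-Real.pi)..Real.pi, (2 * (q (circleMap 0 r θ)).re - 1) / r
        = 2 * Real.pi / r := by
      rw [intervalIntegral.integral_div, intervalIntegral.integral_sub,
        intervalIntegral.integral_const_mul, hre]
      · simp; ring
      · exact (continuous_const.mul hc1).intervalIntegrable _ _
      · simp
    rw [← h3]
    refine intervalIntegral.integral_mono_on (by linarith [Real.pi_pos])
      ((((continuous_const.mul hc1).sub continuous_const).div_const r).intervalIntegrable _ _)
      (hc2.intervalIntegrable _ _) fun θ _ => ?_
    gcongr
    rw [← Complex.normSq_eq_norm_sq, Complex.normSq_apply]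
    nlinarith [sq_nonneg ((q (circleMap 0 r θ)).re - 1), mul_self_nonneg (q (circleMap 0 r θ)).im]
  calc ENNReal.ofReal (2 * Real.pi / r)
      ≤ ENNReal.ofReal (∫ θ in (-Real.pi)..Real.pi, ‖q (circleMap 0 r θ)‖ ^ 2 / r) :=
        ENNReal.ofReal_le_ofReal hle
    _ = ∫⁻ θ in Ioc (-Real.pi) Real.pi, ENNReal.ofReal (‖q (circleMap 0 r θ)‖ ^ 2 / r) := by
        rw [intervalIntegral.integral_of_le (by linarith [Real.pi_pos]),
          MeasureTheory.ofReal_integral_eq_lintegral_ofReal]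
        · exact hc2.integrableOn_Icc.mono_set Ioc_subset_Icc_self
        · exact Filter.Eventually.of_forall fun θ => by simp only [Pi.zero_apply]; positivity
    _ = _ := by
        rw [← MeasureTheory.setLIntegral_congr MeasureTheory.Ioo_ae_eq_Ioc]
        refine MeasureTheory.lintegral_congr fun θ => ?_
        rw [← ENNReal.ofReal_mul hr.le]
        congr 1
        field_simp

lemma kd_ring_lower (q : ℂ → ℂ) (hq : DifferentiableOn ℂ q (Metric.ball 0 1)) (h0 : q 0 = 1)
    (a : ℝ) (ha : 0 < a) (ha1 : a ≤ 1) :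
    ENNReal.ofReal (2 * Real.pi * Real.log (1 / a)) ≤
      ∫⁻ z in {z : ℂ | a < ‖z‖ ∧ ‖z‖ < 1}, ENNReal.ofReal (‖q z‖ ^ 2 / ‖z‖ ^ 2) := by
  have hm : MeasurableSet {z : ℂ | a < ‖z‖ ∧ ‖z‖ < 1} :=
    (measurableSet_lt measurable_const measurable_norm).inter
      (measurableSet_lt measurable_norm measurable_const)
  rw [kd_polar_ring _ a 1 ha, ← kd_lint_inv a 1 _ ha ha1 (by positivity)]
  · refine MeasureTheory.setLIntegral_mono' measurableSet_Ioo fun r hr => ?_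
    have hr0 : 0 < r := ha.trans hr.1
    have := kd_circle q hq h0 r hr0 hr.2
    simpa [abs_of_pos hr0] using this
  · classical
    rw [← piecewise_eq_indicator]
    refine ContinuousOn.measurable_piecewise ?_ continuousOn_const hm
    refine ENNReal.continuous_ofReal.comp_continuousOn ?_
    refine ContinuousOn.div ?_ (by fun_prop) ?_
    · refine (ContinuousOn.norm (hq.continuousOn.mono ?_)).pow 2
      intro z hz; simpa using hz.2
    · intro z hz
      have : 0 < ‖z‖ := ha.trans hz.1
      positivity


lemma kd_inv {f : ℂ → ℂ} {U : Set ℂ} (hU : IsOpen U) (hf : DifferentiableOn ℂ f U)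
    (hinj : InjOn f U) {x : ℂ} (hx : x ∈ U) :
    nhds (f x) ≤ Filter.map f (nhds x) ∧ deriv f x ≠ 0 ∧
      HasDerivAt (Function.invFunOn f U) (deriv f x)⁻¹ (f x) := by
  have hkf : ∀ z ∈ U, Function.invFunOn f U (f z) = z := fun z hz =>
    hinj.leftInvOn_invFunOn hz
  have han : ∀ z ∈ U, AnalyticAt ℂ f z := fun z hz => hf.analyticAt (hU.mem_nhds hz)
  have hnc : ∀ z ∈ U, ¬ ∀ᶠ y in nhds z, f y = f z := by
    intro z hz h
    have h1 : ∀ᶠ y in nhdsWithin z {z}ᶜ, False := by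
      filter_upwards [nhdsWithin_le_nhds h, nhdsWithin_le_nhds (hU.mem_nhds hz),
        self_mem_nhdsWithin] with y h1 h2 h3
      exact h3 (hinj h2 hz h1)
    simpa using h1.exists
  have hA : ∀ z ∈ U, nhds (f z) ≤ Filter.map f (nhds z) := fun z hz =>
    (han z hz).eventually_constant_or_nhds_le_map_nhds.resolve_left (hnc z hz)
  have hB : ∀ z ∈ U, ContinuousAt (Function.invFunOn f U) (f z) := by
    intro z hz
    rw [ContinuousAt, hkf z hz]
    refine Filter.Tendsto.mono_left ?_ (hA z hz)
    rw [Filter.tendsto_map'_iff]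
    refine Filter.tendsto_id.congr' ?_
    filter_upwards [hU.mem_nhds hz] with y hy
    exact (hkf y hy).symm
  have hC : ∀ z ∈ U, ∀ᶠ y in nhds (f z), f (Function.invFunOn f U y) = y := by
    intro z hz
    apply hA z hz
    rw [Filter.mem_map]
    filter_upwards [hU.mem_nhds hz] with y hy
    simp [hkf y hy]
  have hD : ∀ z ∈ U, deriv f z ≠ 0 →
      HasDerivAt (Function.invFunOn f U) (deriv f z)⁻¹ (f z) := by
    intro z hz h
    refine HasDerivAt.of_local_left_inverse (hB z hz) ?_ h (hC z hz)
    rw [hkf z hz]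
    exact (han z hz).differentiableAt.hasDerivAt
  have hE : ∀ᶠ z in nhdsWithin x {x}ᶜ, deriv f z ≠ 0 := by
    refine ((han x hx).deriv.eventually_eq_zero_or_eventually_ne_zero).resolve_left fun h => ?_
    obtain ⟨ρ, hρ, hball⟩ := Metric.mem_nhds_iff.1 (Filter.inter_mem h (hU.mem_nhds hx))
    apply hnc x hx
    filter_upwards [Metric.ball_mem_nhds x hρ] with y hy
    exact Metric.isOpen_ball.is_const_of_deriv_eq_zero (convex_ball x ρ).isPreconnected
      (hf.mono fun w hw => (hball hw).2) (fun w hw => (hball hw).1) hy (Metric.mem_ball_self hρ)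
  have hF : ∀ᶠ y in nhdsWithin (f x) {f x}ᶜ, DifferentiableAt ℂ (Function.invFunOn f U) y := by
    rw [eventually_nhdsWithin_iff]
    apply hA x hx
    rw [Filter.mem_map]
    rw [eventually_nhdsWithin_iff] at hE
    filter_upwards [hE, hU.mem_nhds hx] with z hz hzU hne
    refine (hD z hzU (hz ?_)).differentiableAt
    intro h
    exact hne (by rw [mem_singleton_iff.1 h]; rfl)
  have hG := (Complex.analyticAt_of_differentiable_on_punctured_nhds_of_continuousAt hF
    (hB x hx)).differentiableAt.hasDerivAt
  have hH := hG.comp x (han x hx).differentiableAt.hasDerivAt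
  have hI : HasDerivAt (Function.invFunOn f U ∘ f) 1 x := by
    refine (hasDerivAt_id x).congr_of_eventuallyEq ?_
    filter_upwards [hU.mem_nhds hx] with y hy
    exact hkf y hy
  have hne : deriv f x ≠ 0 := by
    intro h0
    have := hH.unique hI
    rw [h0] at this
    simp at this
  exact ⟨hA x hx, hne, hD x hx hne⟩

lemma kd_schwarz {g : ℂ → ℂ} (hg : DifferentiableOn ℂ g (Metric.ball 0 1))
    (hinj : InjOn g (Metric.ball 0 1)) {R : ℝ} (hR : ‖deriv g 0‖ < R) :
    ∃ u, u ∉ g '' Metric.ball 0 1 ∧ ‖g 0 - u‖ < R := by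
  by_contra! hcon
  have h0 : (0:ℂ) ∈ Metric.ball (0:ℂ) 1 := by simp
  have hR0 : 0 < R := (norm_nonneg _).trans_lt hR
  have hsub : ∀ u ∈ Metric.ball (g 0) R, u ∈ g '' Metric.ball 0 1 := by
    intro u hu
    by_contra h
    have := hcon u h
    rw [mem_ball_iff_norm'] at hu
    linarith
  obtain ⟨-, hne, hd⟩ := kd_inv Metric.isOpen_ball hg hinj h0
  have hk0 : Function.invFunOn g (Metric.ball 0 1) (g 0) = 0 := hinj.leftInvOn_invFunOn h0
  have := Complex.norm_deriv_le_div_of_mapsTo_ball (f := Function.invFunOn g (Metric.ball 0 1))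
    (c := g 0) (R₁ := R) (R₂ := 1) (by
      intro u hu
      obtain ⟨z, hz, rfl⟩ := hsub u hu
      exact (kd_inv Metric.isOpen_ball hg hinj hz).2.2.differentiableAt.differentiableWithinAt)
    (by
      intro u hu
      obtain ⟨z, hz, rfl⟩ := hsub u hu
      rw [hk0, hinj.leftInvOn_invFunOn hz]
      exact Metric.ball_subset_closedBall hz) hR0
  rw [hd.deriv, norm_inv, ← one_div] at this
  have hp : 0 < ‖deriv g 0‖ := norm_pos_iff.2 hne
  rw [div_le_div_iff₀ hp hR0] at this
  linarith

lemma kd_change {k : ℂ → ℂ} {A : Set ℂ} (hA : IsOpen A) (hk : DifferentiableOn ℂ k A)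
    (hinj : InjOn k A) (G : ℂ → ENNReal) :
    ∫⁻ w in k '' A, G w = ∫⁻ z in A, ENNReal.ofReal (‖deriv k z‖ ^ 2) * G (k z) := by
  have := MeasureTheory.lintegral_image_eq_lintegral_abs_det_fderiv_mul
    MeasureTheory.volume hA.measurableSet (f := k)
    (f' := fun z => (ContinuousLinearMap.toSpanSingleton ℂ (deriv k z)).restrictScalars ℝ)
    (fun z hz => ((hk.differentiableAt (hA.mem_nhds hz)).hasDerivAt.hasFDerivAt.restrictScalars
      ℝ).hasFDerivWithinAt) hinj G
  rw [this]
  refine MeasureTheory.lintegral_congr fun z => ?_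
  congr 2
  simp [ContinuousLinearMap.det, LinearMap.det_restrictScalars,
      Algebra.norm_complex_eq, Complex.normSq_eq_norm_sq]


/-- Bieberbach–Eilenberg: derivative bound at the origin. -/
lemma kd_BE {k : ℂ → ℂ} (hk : DifferentiableOn ℂ k (Metric.ball 0 1))
    (hinj : InjOn k (Metric.ball 0 1)) (hk0 : k 0 = 0)
    (hBE : ∀ z ∈ Metric.ball (0:ℂ) 1, ∀ w ∈ Metric.ball (0:ℂ) 1, k z * k w ≠ 1) :
    ‖deriv k 0‖ ≤ 1 := by
  by_contra! ha
  have h0 : (0:ℂ) ∈ Metric.ball (0:ℂ) 1 := by simp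
  obtain ⟨b, hb1, hba⟩ := exists_between ha
  obtain ⟨hmap, hne, -⟩ := kd_inv Metric.isOpen_ball hk hinj h0
  have hkd : ∀ z ∈ Metric.ball (0:ℂ) 1, DifferentiableAt ℂ k z := fun z hz =>
    hk.differentiableAt (Metric.isOpen_ball.mem_nhds hz)
  have hknz : ∀ z ∈ Metric.ball (0:ℂ) 1, z ≠ 0 → k z ≠ 0 := by
    intro z hz hz0 h
    exact hz0 (hinj hz h0 (by rw [h, hk0]))
  have hds : DifferentiableOn ℂ (dslope k 0) (Metric.ball 0 1) :=
    (Complex.differentiableOn_dslope (Metric.ball_mem_nhds 0 one_pos)).2 hk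
  have hdsv : ∀ z, z ≠ 0 → dslope k 0 z = k z / z := by
    intro z hz
    rw [dslope_of_ne _ hz, slope_def_field, hk0, sub_zero, sub_zero]
  have hdsn : ∀ z ∈ Metric.ball (0:ℂ) 1, dslope k 0 z ≠ 0 := by
    intro z hz
    by_cases h : z = 0
    · rw [h, dslope_same]; exact hne
    · rw [hdsv z h]; exact div_ne_zero (hknz z hz h) h
  have hq : DifferentiableOn ℂ (fun z => deriv k z / dslope k 0 z) (Metric.ball 0 1) :=
    (hk.deriv Metric.isOpen_ball).div hds hdsn
  have hq0 : (fun z => deriv k z / dslope k 0 z) 0 = 1 := by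
    simp only [dslope_same]; exact div_self hne
  have hnear : ∀ᶠ z in nhds (0:ℂ), b * ‖z‖ ≤ ‖k z‖ := by
    have hc : ContinuousAt (dslope k 0) 0 :=
      (hds.differentiableAt (Metric.ball_mem_nhds 0 one_pos)).continuousAt
    have hc2 := hc.norm.eventually_const_lt (u := b) (by simpa only [dslope_same] using hba)
    filter_upwards [hc2] with z hz
    by_cases h : z = 0
    · simp [h]
    · rw [hdsv z h, norm_div, lt_div_iff₀ (norm_pos_iff.2 h)] at hz
      exact hz.le
  obtain ⟨η, hη, hηb⟩ := Metric.mem_nhds_iff.1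
    (Filter.inter_mem hnear (Metric.ball_mem_nhds (0:ℂ) one_pos))
  have himg : k '' Metric.ball 0 η ∈ nhds (0:ℂ) := by
    rw [hk0] at hmap
    exact hmap (Filter.image_mem_map (Metric.ball_mem_nhds 0 hη))
  obtain ⟨d, hd, hdb⟩ := Metric.mem_nhds_iff.1 himg
  obtain ⟨e, he0, he⟩ := exists_between (show 0 < min η (min (d / b) (min 1 (1 / b))) by positivity)
  simp only [lt_min_iff] at he
  obtain ⟨heη, hed, he1, heb⟩ := he
  have hb0 : 0 < b := one_pos.trans hb1
  rw [lt_div_iff₀ hb0] at hed heb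
  set c := e * b with hcdef
  have hc0 : 0 < c := by positivity
  set A : Set ℂ := {z : ℂ | e < ‖z‖ ∧ ‖z‖ < 1} with hAdef
  have hAo : IsOpen A := (isOpen_lt continuous_const continuous_norm).inter
    (isOpen_lt continuous_norm continuous_const)
  have hAb : A ⊆ Metric.ball 0 1 := fun z hz => by simpa using hz.2
  have hA0 : ∀ z ∈ A, z ≠ 0 := by
    rintro z hz rfl
    have := hz.1
    simp at this
    linarith
  have hlow : ∀ z ∈ A, c < ‖k z‖ := by
    intro z hz
    by_cases h : ‖z‖ < η
    · have h1 : b * ‖z‖ ≤ ‖k z‖ := (hηb (by simpa using h)).1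
      have := hz.1
      nlinarith
    · by_contra! hcon
      obtain ⟨y, hy, hyz⟩ := hdb (show k z ∈ Metric.ball 0 d by simpa using hcon.trans_lt hed)
      have := hinj (hηb hy).2 (hAb hz) hyz
      subst this
      exact h (by simpa using hy)
  have hup : ∀ z ∈ A, ‖k z‖ < 1 / c := by
    intro z hz
    by_contra! hcon
    have hkz := hknz z (hAb hz) (hA0 z hz)
    have hkp : 0 < ‖k z‖ := norm_pos_iff.2 hkz
    have h1 : ‖(k z)⁻¹‖ ≤ c := by
      rw [norm_inv]
      rw [div_le_iff₀ hc0] at hcon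
      rw [inv_le_iff_one_le_mul₀ hkp]; linarith
    obtain ⟨y, hy, hyz⟩ := hdb (show (k z)⁻¹ ∈ Metric.ball 0 d by simpa using h1.trans_lt hed)
    refine hBE z (hAb hz) y (hηb hy).2 ?_
    rw [hyz]; exact mul_inv_cancel₀ hkz
  have hkA := hk.mono hAb
  have hinjA := hinj.mono hAb
  have hkiA : DifferentiableOn ℂ (fun z => (k z)⁻¹) A :=
    hkA.inv fun z hz => hknz z (hAb hz) (hA0 z hz)
  have hkiinj : InjOn (fun z => (k z)⁻¹) A := by
    intro z hz w hw h
    exact hinjA hz hw (inv_injective h)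
  set I := ∫⁻ z in A, ENNReal.ofReal (‖deriv k z / dslope k 0 z‖ ^ 2 / ‖z‖ ^ 2) with hI
  have hI1 : ∫⁻ w in k '' A, ENNReal.ofReal ((‖w‖ ^ 2)⁻¹) = I := by
    rw [kd_change hAo hkA hinjA]
    refine MeasureTheory.setLIntegral_congr_fun hAo.measurableSet fun z hz => ?_
    have h1 : 0 < ‖z‖ := norm_pos_iff.2 (hA0 z hz)
    have h2 : 0 < ‖k z‖ := hc0.trans (hlow z hz)
    rw [← ENNReal.ofReal_mul (by positivity), hdsv z (hA0 z hz), norm_div, norm_div]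
    congr 1
    field_simp
  have hI2 : ∫⁻ w in (fun z => (k z)⁻¹) '' A, ENNReal.ofReal ((‖w‖ ^ 2)⁻¹) = I := by
    rw [kd_change hAo hkiA hkiinj]
    refine MeasureTheory.setLIntegral_congr_fun hAo.measurableSet fun z hz => ?_
    have h1 : 0 < ‖z‖ := norm_pos_iff.2 (hA0 z hz)
    have h2 : 0 < ‖k z‖ := hc0.trans (hlow z hz)
    have h3 : deriv (fun z => (k z)⁻¹) z = -deriv k z / k z ^ 2 :=
      ((hkd z (hAb hz)).hasDerivAt.inv (norm_pos_iff.1 h2)).deriv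
    rw [h3, ← ENNReal.ofReal_mul (by positivity), hdsv z (hA0 z hz), norm_div, norm_div,
      norm_div, norm_neg, norm_inv, norm_pow]
    congr 1
    field_simp
  have hdisj : Disjoint (k '' A) ((fun z => (k z)⁻¹) '' A) := by
    rw [Set.disjoint_left]
    rintro _ ⟨z, hz, rfl⟩ ⟨w, hw, hwz⟩
    refine hBE z (hAb hz) w (hAb hw) ?_
    simp only at hwz
    rw [← hwz]
    exact inv_mul_cancel₀ (hknz w (hAb hw) (hA0 w hw))
  have hmeas : MeasurableSet ((fun z => (k z)⁻¹) '' A) := by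
    refine MeasureTheory.measurable_image_of_fderivWithin hAo.measurableSet
      (f' := fun z => (fderiv ℂ (fun z => (k z)⁻¹) z).restrictScalars ℝ) (fun z hz => ?_) hkiinj
    exact ((hkiA.differentiableAt (hAo.mem_nhds hz)).hasFDerivAt.restrictScalars
      ℝ).hasFDerivWithinAt
  have hsub : k '' A ∪ (fun z => (k z)⁻¹) '' A ⊆ {z : ℂ | c < ‖z‖ ∧ ‖z‖ < 1 / c} := by
    rintro _ (⟨z, hz, rfl⟩ | ⟨z, hz, rfl⟩)
    · exact ⟨hlow z hz, hup z hz⟩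
    · have h2 : 0 < ‖k z‖ := hc0.trans (hlow z hz)
      have h3 := hlow z hz
      have h4 := hup z hz
      simp only [mem_ofPred_eq, norm_inv]
      rw [lt_div_iff₀ hc0] at h4
      constructor
      · rw [lt_inv_comm₀ hc0 h2, ← one_div, lt_div_iff₀ hc0]; exact h4
      · rw [one_div]; exact inv_strictAnti₀ hc0 h3
  have hupper : I + I ≤ ENNReal.ofReal (2 * Real.pi * Real.log (1 / c / c)) := by
    rw [← kd_ring_area c (1 / c) hc0 (by rw [le_div_iff₀ hc0]; nlinarith)]
    nth_rewrite 1 [← hI1]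
    rw [← hI2, ← MeasureTheory.lintegral_union hmeas hdisj]
    exact MeasureTheory.lintegral_mono_set hsub
  have hlower := kd_ring_lower _ hq hq0 e he0 he1.le
  have hfin : ENNReal.ofReal (2 * Real.pi * Real.log (1 / e) + 2 * Real.pi * Real.log (1 / e)) ≤
      ENNReal.ofReal (2 * Real.pi * Real.log (1 / c / c)) := by
    have hlog : 0 ≤ Real.log (1 / e) := Real.log_nonneg (by rw [le_div_iff₀ he0]; linarith)
    rw [ENNReal.ofReal_add (by positivity) (by positivity)]
    exact (add_le_add hlower hlower).trans hupper
  have hpi := Real.pi_pos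
  have hlogb : 0 < Real.log b := Real.log_pos hb1
  have hlogc : Real.log (1 / c / c) = -2 * (Real.log e + Real.log b) := by
    rw [div_div, Real.log_div one_ne_zero (by positivity), Real.log_mul hc0.ne' hc0.ne', hcdef,
      Real.log_mul he0.ne' hb0.ne', Real.log_one]
    ring
  have hloge : Real.log (1 / e) = - Real.log e := by
    rw [one_div, Real.log_inv]
  have hlogc0 : 0 ≤ Real.log (1 / c / c) :=
    Real.log_nonneg (by rw [div_div, le_div_iff₀ (by positivity)]; nlinarith)
  rw [ENNReal.ofReal_le_ofReal_iff (by positivity), hlogc, hloge] at hfin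
  nlinarith [mul_pos hpi hlogb]

/-- Koebe one-quarter theorem. -/
lemma kd_koebe {g : ℂ → ℂ} (hg : DifferentiableOn ℂ g (Metric.ball 0 1))
    (hinj : InjOn g (Metric.ball 0 1)) {u : ℂ} (hu : u ∉ g '' Metric.ball 0 1) :
    ‖deriv g 0‖ ≤ 4 * ‖g 0 - u‖ := by
  have h0 : (0:ℂ) ∈ Metric.ball (0:ℂ) 1 := by simp
  have hne : ∀ z ∈ Metric.ball (0:ℂ) 1, g z - u ≠ 0 := by
    intro z hz h
    exact hu ⟨z, hz, sub_eq_zero.1 h⟩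
  have hgd : ∀ z ∈ Metric.ball (0:ℂ) 1, HasDerivAt g (deriv g z) z := fun z hz =>
    (hg.differentiableAt (Metric.isOpen_ball.mem_nhds hz)).hasDerivAt
  have hL : DifferentiableOn ℂ (fun z => deriv g z / (g z - u)) (Metric.ball 0 1) :=
    (hg.deriv Metric.isOpen_ball).div (hg.sub_const u) hne
  obtain ⟨P, hP0, hP⟩ := hL.isExactOn_ball.with_val_at 0 0
  have hconst : ∀ z ∈ Metric.ball (0:ℂ) 1, (g z - u) * Complex.exp (-P z) = g 0 - u := by
    have hd : ∀ z ∈ Metric.ball (0:ℂ) 1,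
        HasDerivAt (fun z => (g z - u) * Complex.exp (-P z)) 0 z := by
      intro z hz
      have := ((hgd z hz).sub_const u).mul (hP z hz).neg.cexp
      refine this.congr_deriv ?_
      have hn := hne z hz
      have e : (g z - u) * (deriv g z / (g z - u)) = deriv g z := mul_div_cancel₀ _ hn
      try simp only [Pi.neg_apply]
      linear_combination -Complex.exp (-P z) * e
    intro z hz
    have := Metric.isOpen_ball.is_const_of_deriv_eq_zero (convex_ball (0:ℂ) 1).isPreconnected
      (fun w hw => (hd w hw).differentiableAt.differentiableWithinAt)
      (fun w hw => (hd w hw).deriv) hz h0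
    simpa [hP0] using this
  set h : ℂ → ℂ := fun z => Complex.exp (P z / 2) with hh
  have hh0 : h 0 = 1 := by simp [hh, hP0]
  have hsq : ∀ z ∈ Metric.ball (0:ℂ) 1, h z ^ 2 * (g 0 - u) = g z - u := by
    intro z hz
    rw [← hconst z hz, hh]
    simp only
    rw [← Complex.exp_nat_mul, mul_comm, mul_assoc, ← Complex.exp_add]
    push_cast
    rw [show -P z + 2 * (P z / 2) = 0 by ring]
    simp
  have hhn : ∀ z, h z ≠ 0 := fun z => Complex.exp_ne_zero _
  have hgeq : ∀ z ∈ Metric.ball (0:ℂ) 1, ∀ w ∈ Metric.ball (0:ℂ) 1, h z ^ 2 = h w ^ 2 → z = w := by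
    intro z hz w hw e
    apply hinj hz hw
    have h1 := hsq z hz
    have h2 := hsq w hw
    rw [e, h2] at h1
    linear_combination -h1
  have hp1 : ∀ z ∈ Metric.ball (0:ℂ) 1, h z + 1 ≠ 0 := by
    intro z hz e
    have e1 : h z = -1 := by linear_combination e
    have := hgeq z hz 0 h0 (by rw [e1, hh0]; norm_num)
    rw [this, hh0] at e1
    norm_num at e1
  have hhd : ∀ z ∈ Metric.ball (0:ℂ) 1,
      HasDerivAt h (h z * (deriv g z / (g z - u) / 2)) z := fun z hz =>
    ((hP z hz).div_const 2).cexp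
  have hkd : ∀ z ∈ Metric.ball (0:ℂ) 1, HasDerivAt (fun z => (h z - 1) / (h z + 1))
      ((h z * (deriv g z / (g z - u) / 2) * (h z + 1) -
        (h z - 1) * (h z * (deriv g z / (g z - u) / 2))) / (h z + 1) ^ 2) z := fun z hz =>
    ((hhd z hz).sub_const 1).div ((hhd z hz).add_const 1) (hp1 z hz)
  have key := kd_BE (k := fun z => (h z - 1) / (h z + 1))
    (fun z hz => (hkd z hz).differentiableAt.differentiableWithinAt)
    (by
      intro z hz w hw e
      simp only at e
      rw [div_eq_div_iff (hp1 z hz) (hp1 w hw)] at e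
      refine hgeq z hz w hw ?_
      have : h z = h w := by linear_combination e / 2
      rw [this])
    (by simp [hh0])
    (by
      intro z hz w hw e
      rw [div_mul_div_comm, div_eq_one_iff_eq (mul_ne_zero (hp1 z hz) (hp1 w hw))] at e
      have e1 : h z = - h w := by linear_combination -e / 2
      have := hgeq z hz w hw (by rw [e1]; ring)
      subst this
      exact hhn z (by linear_combination e1 / 2))
  rw [(hkd 0 h0).deriv, hh0] at key
  have hpos : 0 < ‖g 0 - u‖ := norm_pos_iff.2 (hne 0 h0)
  have e : (1 * (deriv g 0 / (g 0 - u) / 2) * (1 + 1) -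
        (1 - 1) * (1 * (deriv g 0 / (g 0 - u) / 2))) / (1 + 1) ^ 2 = deriv g 0 / (4 * (g 0 - u)) := by
    have := hne 0 h0
    field_simp; ring
  rw [e, norm_div, norm_mul, div_le_one (by simpa using hne 0 h0)] at key
  simpa using key


lemma kd_koebe_pt {g : ℂ → ℂ} (hg : DifferentiableOn ℂ g (Metric.ball 0 1))
    (hinj : InjOn g (Metric.ball 0 1)) {u : ℂ} (hu : u ∉ g '' Metric.ball 0 1)
    {p : ℂ} (hp : p ∈ Metric.ball (0:ℂ) 1) :
    ‖deriv g p‖ * (1 - ‖p‖ ^ 2) ≤ 4 * ‖g p - u‖ := by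
  have h0 : (0:ℂ) ∈ Metric.ball (0:ℂ) 1 := by simp
  have hp1 : ‖p‖ < 1 := by simpa using hp
  have hps : 0 < 1 - ‖p‖ ^ 2 := by nlinarith [norm_nonneg p]
  have hpc : p * (starRingEnd ℂ) p = ((‖p‖ ^ 2 : ℝ) : ℂ) := by
    rw [Complex.mul_conj, Complex.normSq_eq_norm_sq]
  have hden : ∀ x ∈ Metric.ball (0:ℂ) 1, 1 + (starRingEnd ℂ) p * x ≠ 0 := by
    intro x hx h
    have hx1 : ‖x‖ < 1 := by simpa using hx
    have e : (starRingEnd ℂ) p * x = -1 := by linear_combination h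
    have e2 := congrArg norm e
    rw [norm_mul, RCLike.norm_conj, norm_neg, norm_one] at e2
    nlinarith [norm_nonneg p, norm_nonneg x]
  set ψ : ℂ → ℂ := fun x => (x + p) / (1 + (starRingEnd ℂ) p * x) with hψ
  have hψd : ∀ x ∈ Metric.ball (0:ℂ) 1, HasDerivAt ψ
      ((1 * (1 + (starRingEnd ℂ) p * x) - (x + p) * ((starRingEnd ℂ) p * 1)) /
        (1 + (starRingEnd ℂ) p * x) ^ 2) x := fun x hx =>
    ((hasDerivAt_id x).add_const p).div
      (((hasDerivAt_id x).const_mul ((starRingEnd ℂ) p)).const_add 1) (hden x hx)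
  have hmaps : MapsTo ψ (Metric.ball 0 1) (Metric.ball 0 1) := by
    intro x hx
    have hx1 : ‖x‖ < 1 := by simpa using hx
    have hxs : 0 < 1 - ‖x‖ ^ 2 := by nlinarith [norm_nonneg x]
    have hd := hden x hx
    rw [mem_ball_zero_iff, hψ]
    simp only [norm_div]
    rw [div_lt_one (norm_pos_iff.2 hd)]
    refine lt_of_pow_lt_pow_left₀ 2 (norm_nonneg _) ?_
    have := mul_pos hps hxs
    simp only [← Complex.normSq_eq_norm_sq, Complex.normSq_apply] at this ⊢
    simp only [Complex.add_re, Complex.add_im, Complex.mul_re, Complex.mul_im, Complex.conj_re,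
      Complex.conj_im, Complex.one_re, Complex.one_im]
    nlinarith
  have hψinj : InjOn ψ (Metric.ball 0 1) := by
    intro x hx y hy e
    simp only [hψ] at e
    rw [div_eq_div_iff (hden x hx) (hden y hy)] at e
    have e2 : (x - y) * (1 - p * (starRingEnd ℂ) p) = 0 := by linear_combination e
    rcases mul_eq_zero.1 e2 with h | h
    · exact sub_eq_zero.1 h
    · rw [hpc] at h
      exact absurd (by exact_mod_cast h) hps.ne'
  have hψ0 : ψ 0 = p := by simp [hψ]
  have hc : HasDerivAt (g ∘ ψ) (deriv g p * (1 - ((‖p‖ ^ 2 : ℝ) : ℂ))) 0 := by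
    have h1 := hψd 0 h0
    have h2 : HasDerivAt g (deriv g p) (ψ 0) := by
      rw [hψ0]; exact (hg.differentiableAt (Metric.isOpen_ball.mem_nhds hp)).hasDerivAt
    refine (h2.comp 0 h1).congr_deriv ?_
    rw [← hpc]; simp
  have key := kd_koebe (g := g ∘ ψ) (u := u)
    (hg.comp (fun x hx => (hψd x hx).differentiableAt.differentiableWithinAt) hmaps)
    (hinj.comp hψinj hmaps)
    (by
      rintro ⟨x, hx, rfl⟩
      exact hu ⟨ψ x, hmaps hx, rfl⟩)
  rw [hc.deriv, norm_mul, Function.comp_apply, hψ0] at key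
  rw [← Complex.ofReal_one, ← Complex.ofReal_sub, Complex.norm_real, Real.norm_of_nonneg hps.le]
    at key
  exact key

lemma kd_growth {g : ℂ → ℂ} (hg : DifferentiableOn ℂ g (Metric.ball 0 1))
    (hinj : InjOn g (Metric.ball 0 1)) {x : ℂ} (hx : x ∈ Metric.ball (0:ℂ) 1) :
    ‖g x - g 0‖ ≤ ‖deriv g 0‖ * ((1 + ‖x‖) / (1 - ‖x‖)) ^ 4 := by
  have h0 : (0:ℂ) ∈ Metric.ball (0:ℂ) 1 := by simp
  have hx1 : ‖x‖ < 1 := by simpa using hx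
  by_cases hx0 : x = 0
  · simp [hx0]
  set r := ‖x‖ with hr
  have hr0 : 0 < r := norm_pos_iff.2 hx0
  have hlam : 0 < ‖deriv g 0‖ :=
    norm_pos_iff.2 (kd_inv Metric.isOpen_ball hg hinj h0).2.1
  set L := ‖deriv g 0‖ with hL
  set Q := ((1 + r) / (1 - r)) ^ 4 with hQ
  have hQ1 : 1 < Q := by
    refine one_lt_pow₀ ?_ (by norm_num)
    rw [lt_div_iff₀ (by linarith)]; linarith
  have hQm : 0 < Q - 1 := by linarith
  obtain ⟨u, hu, huR⟩ := kd_schwarz hg hinj (R := L * Q / (Q - 1)) (by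
    rw [lt_div_iff₀ hQm]; nlinarith)
  set R := L * Q / (Q - 1) with hR
  have hR0 : 0 < R := by positivity
  set e : ℂ := x / (r : ℂ) with he
  have hrc : (r : ℂ) ≠ 0 := by exact_mod_cast hr0.ne'
  have hen : ‖e‖ = 1 := by
    rw [he, norm_div, Complex.norm_real, Real.norm_of_nonneg hr0.le]
    exact div_self hr0.ne'
  have hte : ∀ t ∈ Icc (0:ℝ) r, ‖(t : ℂ) * e‖ = t := by
    intro t ht
    rw [norm_mul, hen, Complex.norm_real, Real.norm_of_nonneg ht.1, mul_one]
  have hmem : ∀ t ∈ Icc (0:ℝ) r, (t : ℂ) * e ∈ Metric.ball (0:ℂ) 1 := by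
    intro t ht
    rw [mem_ball_zero_iff, hte t ht]
    exact ht.2.trans_lt hx1
  have hGd : ∀ t ∈ Icc (0:ℝ) r, HasDerivAt (fun t : ℝ => g ((t : ℂ) * e) - g 0)
      (deriv g ((t : ℂ) * e) * e) t := by
    intro t ht
    have h1 := (hg.differentiableAt (Metric.isOpen_ball.mem_nhds (hmem t ht))).hasDerivAt
    have h2 : HasDerivAt (fun s : ℝ => (s : ℂ) * e) e t := by
      simpa using (Complex.ofRealCLM.hasDerivAt (x := t)).mul_const e
    exact (HasDerivAt.comp t h1 h2).sub_const (g 0)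
  have hBd : ∀ t ∈ Icc (0:ℝ) r, HasDerivAt (fun t : ℝ => R * (((1 + t) / (1 - t)) ^ 4 - 1))
      (8 * R * ((1 + t) / (1 - t)) ^ 4 / (1 - t ^ 2)) t := by
    intro t ht
    have h1 : 1 - t ≠ 0 := by have := ht.2; intro h; linarith
    have h2 : 1 + t ≠ 0 := by have := ht.1; intro h; linarith
    have h3 : 1 - t ^ 2 ≠ 0 := by
      rw [show 1 - t ^ 2 = (1 - t) * (1 + t) by ring]; exact mul_ne_zero h1 h2
    have h4 : HasDerivAt (fun t : ℝ => (1 + t) / (1 - t))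
        ((1 * (1 - t) - (1 + t) * (-1)) / (1 - t) ^ 2) t :=
      ((hasDerivAt_id t).const_add 1).div ((hasDerivAt_id t).const_sub 1) h1
    refine (((h4.pow 4).sub_const 1).const_mul R).congr_deriv ?_
    rw [show (4 - 1 : ℕ) = 3 from rfl]
    push_cast
    rw [show 1 - t ^ 2 = (1 - t) * (1 + t) by ring]
    field_simp
    ring
  have key := image_norm_le_of_norm_deriv_right_lt_deriv_boundary'
    (f := fun t : ℝ => g ((t : ℂ) * e) - g 0) (f' := fun t : ℝ => deriv g ((t : ℂ) * e) * e)
    (a := 0) (b := r) (B := fun t : ℝ => R * (((1 + t) / (1 - t)) ^ 4 - 1))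
    (B' := fun t : ℝ => 8 * R * ((1 + t) / (1 - t)) ^ 4 / (1 - t ^ 2))
    (fun t ht => (hGd t ht).continuousAt.continuousWithinAt)
    (fun t ht => (hGd t (Ico_subset_Icc_self ht)).hasDerivWithinAt)
    (by simp)
    (fun t ht => (hBd t ht).continuousAt.continuousWithinAt)
    (fun t ht => (hBd t (Ico_subset_Icc_self ht)).hasDerivWithinAt)
    (by
      intro t ht hB
      have ht' := Ico_subset_Icc_self ht
      have hk := kd_koebe_pt hg hinj hu (hmem t ht')
      rw [hte t ht'] at hk
      have ht1 : t < 1 := ht.2.trans hx1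
      have hpos : 0 < 1 - t ^ 2 := by nlinarith [ht.1]
      have htri : ‖g ((t : ℂ) * e) - u‖ ≤ ‖g ((t : ℂ) * e) - g 0‖ + ‖g 0 - u‖ :=
        norm_sub_le_norm_sub_add_norm_sub _ _ _
      rw [hB] at htri
      have hq : 0 < ((1 + t) / (1 - t)) ^ 4 := by
        have := ht.1
        have : 0 < 1 - t := by linarith
        positivity
      rw [norm_mul, hen, mul_one, lt_div_iff₀ hpos]
      nlinarith [mul_pos hR0 hq])
    (right_mem_Icc.2 hr0.le)
  rw [he, mul_div_cancel₀ _ hrc] at key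
  refine key.trans (le_of_eq ?_)
  rw [hR, ← hQ]
  field_simp

lemma kd_exp_hypDist {z w : ℂ} (hz : 0 < z.im) (hw : 0 < w.im) :
    ‖(w - z) / (w - (starRingEnd ℂ) z)‖ < 1 ∧
    Real.exp (hypDist z w) = (1 + ‖(w - z) / (w - (starRingEnd ℂ) z)‖) /
      (1 - ‖(w - z) / (w - (starRingEnd ℂ) z)‖) := by
  have hM : ‖w - (starRingEnd ℂ) z‖ ^ 2 = ‖w - z‖ ^ 2 + 4 * z.im * w.im := by
    simp only [← Complex.normSq_eq_norm_sq, Complex.normSq_apply]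
    simp only [Complex.sub_re, Complex.sub_im, Complex.conj_re, Complex.conj_im]
    ring
  rw [norm_div]
  unfold hypDist arcoshReal
  rw [norm_sub_rev z w]
  set m := ‖w - z‖ with hm
  set M := ‖w - (starRingEnd ℂ) z‖ with hMd
  have hm0 : 0 ≤ m := norm_nonneg _
  have hM0 : 0 ≤ M := norm_nonneg _
  have hyv : 0 < z.im * w.im := mul_pos hz hw
  have hlt : m < M := by
    refine lt_of_pow_lt_pow_left₀ 2 hM0 ?_
    rw [hM]; linarith
  have hMp : 0 < M := hm0.trans_lt hlt
  have hd : 0 < M - m := by linarith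
  have hD : 0 < M ^ 2 - m ^ 2 := by rw [hM]; linarith
  refine ⟨(div_lt_one hMp).2 hlt, ?_⟩
  have e1 : 1 + m ^ 2 / (2 * z.im * w.im) = (M ^ 2 + m ^ 2) / (M ^ 2 - m ^ 2) := by
    have : M ^ 2 - m ^ 2 = 4 * z.im * w.im := by rw [hM]; ring
    rw [this, hM]
    field_simp
    ring
  have e2 : ((M ^ 2 + m ^ 2) / (M ^ 2 - m ^ 2)) ^ 2 - 1 = (2 * M * m / (M ^ 2 - m ^ 2)) ^ 2 := by
    field_simp
    ring
  rw [e1, e2, Real.sqrt_sq (by positivity), Real.exp_log (by positivity)]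
  have h1 : 1 - m / M ≠ 0 := by
    have := (div_lt_one hMp).2 hlt
    intro h; linarith
  rw [← add_div, div_eq_div_iff hD.ne' h1]
  field_simp
  ring


/-- **Distortion estimate for conformal maps of ℍ.** If `f : ℍ → ℂ` is holomorphic and
injective on the upper half-plane, then for all `z, w ∈ ℍ`,
`|f(z) − f(w)| ≤ 2 (Im z)|f'(z)| exp(4 d_{ℍ,hyp}(z,w))`. -/
theorem conformal_distortion_hyperbolic
    (f : ℂ → ℂ) (hf : DifferentiableOn ℂ f UHP) (hinj : Set.InjOn f UHP) :
    ∀ z ∈ UHP, ∀ w ∈ UHP,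
      ‖f z - f w‖ ≤ 2 * z.im * ‖deriv f z‖ * Real.exp (4 * hypDist z w) := by
  intro z hz w hw
  have hz' : 0 < z.im := hz
  have hw' : 0 < w.im := hw
  obtain ⟨hx1, hexp⟩ := kd_exp_hypDist hz' hw'
  have h0 : (0:ℂ) ∈ Metric.ball (0:ℂ) 1 := by simp
  have hUo : IsOpen UHP := isOpen_lt continuous_const Complex.continuous_im
  set x := (w - z) / (w - (starRingEnd ℂ) z) with hx
  have hzz : z - (starRingEnd ℂ) z ≠ 0 := by
    intro h
    have := congrArg Complex.im h
    simp at this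
    linarith
  have hwz : w - (starRingEnd ℂ) z ≠ 0 := by
    intro h
    have := congrArg Complex.im h
    simp at this
    linarith
  have hden : ∀ y ∈ Metric.ball (0:ℂ) 1, 1 - y ≠ 0 := by
    intro y hy h
    have e : y = 1 := by linear_combination -h
    rw [e] at hy
    simp at hy
  set φ : ℂ → ℂ := fun y => (z - (starRingEnd ℂ) z * y) / (1 - y) with hφ
  have hφd : ∀ y ∈ Metric.ball (0:ℂ) 1, HasDerivAt φ
      ((-((starRingEnd ℂ) z * 1) * (1 - y) - (z - (starRingEnd ℂ) z * y) * (-1)) / (1 - y) ^ 2)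
      y := fun y hy =>
    (((hasDerivAt_id y).const_mul ((starRingEnd ℂ) z)).const_sub z).div
      ((hasDerivAt_id y).const_sub 1) (hden y hy)
  have hmaps : MapsTo φ (Metric.ball 0 1) UHP := by
    intro y hy
    have hy1 : ‖y‖ < 1 := by simpa using hy
    have hys : 0 < 1 - ‖y‖ ^ 2 := by nlinarith [norm_nonneg y]
    have hN : 0 < Complex.normSq (1 - y) := Complex.normSq_pos.2 (hden y hy)
    show 0 < ((z - (starRingEnd ℂ) z * y) / (1 - y)).im
    have e : ((z - (starRingEnd ℂ) z * y) / (1 - y)).im =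
        z.im * (1 - ‖y‖ ^ 2) / Complex.normSq (1 - y) := by
      rw [Complex.div_im, ← sub_div, ← Complex.normSq_eq_norm_sq, Complex.normSq_apply y]
      congr 1
      simp only [Complex.sub_re, Complex.sub_im, Complex.mul_re, Complex.mul_im, Complex.conj_re,
        Complex.conj_im, Complex.one_re, Complex.one_im]
      ring
    rw [e]; positivity
  have hφinj : InjOn φ (Metric.ball 0 1) := by
    intro a ha b hb e
    simp only [hφ] at e
    rw [div_eq_div_iff (hden a ha) (hden b hb)] at e
    have e2 : (z - (starRingEnd ℂ) z) * (a - b) = 0 := by linear_combination e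
    exact sub_eq_zero.1 ((mul_eq_zero.1 e2).resolve_left hzz)
  have hφ0 : φ 0 = z := by simp [hφ]
  have hxb : x ∈ Metric.ball (0:ℂ) 1 := by simpa using hx1
  have hφx : φ x = w := by
    simp only [hφ]
    rw [div_eq_iff (hden x hxb), hx]
    field_simp
    ring
  have hfz : HasDerivAt f (deriv f z) (φ 0) := by
    rw [hφ0]; exact (hf.differentiableAt (hUo.mem_nhds hz)).hasDerivAt
  have hc := hfz.comp 0 (hφd 0 h0)
  have key := kd_growth (g := f ∘ φ)
    (hf.comp (fun y hy => (hφd y hy).differentiableAt.differentiableWithinAt) hmaps)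
    (hinj.comp hφinj hmaps) hxb
  rw [hc.deriv, ← hexp, ← Real.exp_nat_mul, Function.comp_apply, Function.comp_apply, hφ0, hφx,
    norm_sub_rev] at key
  refine key.trans (le_of_eq ?_)
  have e3 : (-((starRingEnd ℂ) z * 1) * (1 - 0) - (z - (starRingEnd ℂ) z * 0) * (-1)) / (1 - 0) ^ 2
      = ((2 * z.im : ℝ) : ℂ) * Complex.I := by
    rw [← Complex.sub_conj]; ring
  rw [e3, norm_mul, norm_mul, Complex.norm_I, Complex.norm_real,
    Real.norm_of_nonneg (by positivity : (0:ℝ) ≤ 2 * z.im)]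
  push_cast
  ring

end
end
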